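/- Quadratic commutation relation: for every f ∈ 𝒫_Y, (1/(1+b))·( T_Z̃(W f) − W(T_Z̃ f) ) = W(W f). (This is the relation [Ω_Z^{(k)} + □^{(k)}, Y_+∏_{i=1}^{k}(Λ_Y+u_i)] = (Y_+∏_{i=1}^{k}(Λ_Y+u_i))² as operators on 𝒫_Y, where Ω_Z^{(k)} + □^{(k)} = (1/(1+b))·T_Z̃.) -/

import Mathlib

open MvPolynomial

noncomputable section

/-- The base field `K = ℚ(b)`: rational functions in an indeterminate `b` over `ℚ`. -/
abbrev K : Type := RatFunc ℚ

/-- The indeterminate `b ∈ K`. -/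
def bb : K := RatFunc.X

/-- `α = 1 + b`. -/
def alpha : K := 1 + bb

/-- Variables: `p i` (used for `i ≥ 1`) and `y i`, `y' i`, `z i`, `z' i` (`i ≥ 0`). -/
inductive Var : Type
  | p : ℕ → Var
  | y : ℕ → Var
  | y' : ℕ → Var
  | z : ℕ → Var
  | z' : ℕ → Var
  deriving DecidableEq

/-- The ambient polynomial ring `R′`. -/
abbrev R : Type := MvPolynomial Var K

/-- The generic operator
`Λ_A = α Σ_{i,j≥1} i a_{i+j−1} ∂²/∂p_i∂a_{j−1} + Σ_{i,j≥1} a_{i−1} p_j ∂/∂a_{i+j−1}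
     + b Σ_{i≥1} i a_i ∂/∂a_i` for the alphabet `a ∈ {y, y′, z, z′}`. -/
def Lam (a : ℕ → Var) (f : R) : R :=
  alpha • (∑ᶠ (i : ℕ) (j : ℕ), ((i + 1 : ℕ) : K) •
      (X (a (i + j + 1)) * pderiv (Var.p (i + 1)) (pderiv (a j) f)))
    + (∑ᶠ (i : ℕ) (j : ℕ), X (a i) * X (Var.p (j + 1)) * pderiv (a (i + j + 1)) f)
    + bb • (∑ᶠ (i : ℕ), ((i + 1 : ℕ) : K) • (X (a (i + 1)) * pderiv (a (i + 1)) f))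

/-- The generic shift operator `A_+ = Σ_{i≥0} a_{i+1} ∂/∂a_i`. -/
def Plus (a : ℕ → Var) (f : R) : R := ∑ᶠ (i : ℕ), X (a (i + 1)) * pderiv (a i) f

/-- The generic operator `Θ_A = Σ_{i≥1} p_i ∂/∂a_i`. -/
def Theta (a : ℕ → Var) (f : R) : R := ∑ᶠ (i : ℕ), X (Var.p (i + 1)) * pderiv (a (i + 1)) f

/-- `M_Z = α Σ_{i,j,k≥1} y′_{i+j−1} z′_{k−1} ∂²/∂y_{i+k−1}∂z_{j−1}
         + Σ_{i,j,k≥1} y_{i+j−1} z_{k−1} ∂²/∂y′_{i+k−1}∂z′_{j−1}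
         + b Σ_{i,j,k≥1} y′_{i+j−1} z′_{k−1} ∂²/∂y′_{i+k−1}∂z′_{j−1}`. -/
def MZ (f : R) : R :=
  alpha • (∑ᶠ (i : ℕ) (j : ℕ) (k : ℕ), X (Var.y' (i + j + 1)) * X (Var.z' k) *
      pderiv (Var.y (i + k + 1)) (pderiv (Var.z j) f))
    + (∑ᶠ (i : ℕ) (j : ℕ) (k : ℕ), X (Var.y (i + j + 1)) * X (Var.z k) *
      pderiv (Var.y' (i + k + 1)) (pderiv (Var.z' j) f))
    + bb • (∑ᶠ (i : ℕ) (j : ℕ) (k : ℕ), X (Var.y' (i + j + 1)) * X (Var.z' k) *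
      pderiv (Var.y' (i + k + 1)) (pderiv (Var.z' j) f))

/-- `M_Y`: obtained from `M_Z` by exchanging `y ↔ z` and `y′ ↔ z′` everywhere. -/
def MY (f : R) : R :=
  alpha • (∑ᶠ (i : ℕ) (j : ℕ) (k : ℕ), X (Var.z' (i + j + 1)) * X (Var.y' k) *
      pderiv (Var.z (i + k + 1)) (pderiv (Var.y j) f))
    + (∑ᶠ (i : ℕ) (j : ℕ) (k : ℕ), X (Var.z (i + j + 1)) * X (Var.y k) *
      pderiv (Var.z' (i + k + 1)) (pderiv (Var.y' j) f))
    + bb • (∑ᶠ (i : ℕ) (j : ℕ) (k : ℕ), X (Var.z' (i + j + 1)) * X (Var.y' k) *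
      pderiv (Var.z' (i + k + 1)) (pderiv (Var.y' j) f))

/-- `Λ_Ỹ = Λ_Y + Λ_{Y′} + M_Y`. -/
def LamYt (f : R) : R := Lam Var.y f + Lam Var.y' f + MY f

/-- `Λ_Z̃ = Λ_Z + Λ_{Z′} + M_Z`. -/
def LamZt (f : R) : R := Lam Var.z f + Lam Var.z' f + MZ f

/-- `Ỹ_+ = Y_+ + Y′_+`. -/
def Ytplus (f : R) : R := Plus Var.y f + Plus Var.y' f

/-- `Z̃_+ = Z_+ + Z′_+`. -/
def Ztplus (f : R) : R := Plus Var.z f + Plus Var.z' f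

/-- `Θ_Z̃ = ∂/∂z₀ + Σ_{i≥1} p_i ∂/∂z_i + Σ_{i,j≥0} y_{i+j} ∂²/∂y′_i∂z′_j`. -/
def ThZt (f : R) : R :=
  pderiv (Var.z 0) f + (∑ᶠ (i : ℕ), X (Var.p (i + 1)) * pderiv (Var.z (i + 1)) f)
    + (∑ᶠ (i : ℕ) (j : ℕ), X (Var.y (i + j)) * pderiv (Var.y' i) (pderiv (Var.z' j) f))

/-- `Θ_Ỹ = ∂/∂y₀ + Σ_{i≥1} p_i ∂/∂y_i + Σ_{i,j≥0} z_{i+j} ∂²/∂z′_i∂y′_j`. -/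
def ThYt (f : R) : R :=
  pderiv (Var.y 0) f + (∑ᶠ (i : ℕ), X (Var.p (i + 1)) * pderiv (Var.y (i + 1)) f)
    + (∑ᶠ (i : ℕ) (j : ℕ), X (Var.z (i + j)) * pderiv (Var.z' i) (pderiv (Var.y' j) f))

/-- `Δ = α Σ_{i,j≥0} z′_i y′_j ∂²/∂y_i∂z_j + Σ_{i,j≥0} z_i y_j ∂²/∂y′_i∂z′_j
      + b Σ_{i,j≥0} z′_i y′_j ∂²/∂y′_i∂z′_j`. -/
def Delta (f : R) : R :=
  alpha • (∑ᶠ (i : ℕ) (j : ℕ), X (Var.z' i) * X (Var.y' j) *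
      pderiv (Var.y i) (pderiv (Var.z j) f))
    + (∑ᶠ (i : ℕ) (j : ℕ), X (Var.z i) * X (Var.y j) *
      pderiv (Var.y' i) (pderiv (Var.z' j) f))
    + bb • (∑ᶠ (i : ℕ) (j : ℕ), X (Var.z' i) * X (Var.y' j) *
      pderiv (Var.y' i) (pderiv (Var.z' j) f))

/-- `𝒫`: the subalgebra of polynomials in the `p`-variables only. -/
def Psub : Subalgebra K R := MvPolynomial.supported K (Set.range Var.p)

/-- `𝒫_Y`: the `K`-linear span of the monomials `p_λ` and `y_i·p_λ`. -/
def PY : Submodule K R :=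
  Submodule.span K ((Psub : Set R) ∪
    {g : R | ∃ i : ℕ, ∃ f ∈ (Psub : Set R), g = X (Var.y i) * f})

/-- `𝒫_{Ỹ,Z̃}`: the `K`-linear span of the monomials
`p_λ, y_i·p_λ, z_j·p_λ, y_i·z_j·p_λ, y′_i·p_λ, z′_j·p_λ, y′_i·z′_j·p_λ`. -/
def PYZt : Submodule K R :=
  Submodule.span K ((Psub : Set R) ∪
    {g : R | ∃ f ∈ (Psub : Set R),
      (∃ i : ℕ, g = X (Var.y i) * f) ∨ (∃ j : ℕ, g = X (Var.z j) * f) ∨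
      (∃ i : ℕ, ∃ j : ℕ, g = X (Var.y i) * X (Var.z j) * f) ∨
      (∃ i : ℕ, g = X (Var.y' i) * f) ∨ (∃ j : ℕ, g = X (Var.z' j) * f) ∨
      (∃ i : ℕ, ∃ j : ℕ, g = X (Var.y' i) * X (Var.z' j) * f)})

/-- `Λ_Z̃ + u`: the operator `f ↦ Λ_Z̃ f + u·f`. -/
def LuZt (u : K) (f : R) : R := LamZt f + u • f

/-- `Λ_Z + u`: the operator `f ↦ Λ_Z f + u·f`. -/
def LuZ (u : K) (f : R) : R := Lam Var.z f + u • f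

/-- `Λ_Y + u`: the operator `f ↦ Λ_Y f + u·f`. -/
def LuY (u : K) (f : R) : R := Lam Var.y f + u • f

/-- The composition `(Λ_Z̃+u₁) ∘ ⋯ ∘ (Λ_Z̃+u_k)`. -/
def prodLuZt (k : ℕ) (u : Fin k → K) : R → R :=
  (List.ofFn (fun i => LuZt (u i))).foldr (fun g h => g ∘ h) (id : R → R)

/-- The composition `(Λ_Z+u₁) ∘ ⋯ ∘ (Λ_Z+u_k)`. -/
def prodLuZ (k : ℕ) (u : Fin k → K) : R → R :=
  (List.ofFn (fun i => LuZ (u i))).foldr (fun g h => g ∘ h) (id : R → R)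

/-- The composition `(Λ_Y+u₁) ∘ ⋯ ∘ (Λ_Y+u_k)`. -/
def prodLuY (k : ℕ) (u : Fin k → K) : R → R :=
  (List.ofFn (fun i => LuY (u i))).foldr (fun g h => g ∘ h) (id : R → R)

/-- `T_Z̃ g = Θ_Z̃(Z̃_+((Λ_Z̃+u₁)⋯(Λ_Z̃+u_k)(Λ_Z̃(z₀·g))))`. -/
def TZt (k : ℕ) (u : Fin k → K) (g : R) : R :=
  ThZt (Ztplus (prodLuZt k u (LamZt (X (Var.z 0) * g))))

/-- `T_Z g = Θ_Z(Z_+((Λ_Z+u₁)⋯(Λ_Z+u_k)(Λ_Z(z₀·g))))`. -/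
def TZ (k : ℕ) (u : Fin k → K) (g : R) : R :=
  Theta Var.z (Plus Var.z (prodLuZ k u (Lam Var.z (X (Var.z 0) * g))))

/-- `W g = Y_+((Λ_Y+u₁)⋯(Λ_Y+u_k) g)`. -/
def Wo (k : ℕ) (u : Fin k → K) (g : R) : R := Plus Var.y (prodLuY k u g)

section alg
variable {F E : Type*} [Field F] [Ring E] [Algebra F E]

/-- The product `∏ (L + u)` over a list of scalars `u`. -/
def shiftProd (l : List F) (L : E) : E := (l.map fun u => L + algebraMap F E u).prod

lemma shiftProd_cons (a : F) (l : List F) (L : E) :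
    shiftProd (a :: l) L = (L + algebraMap F E a) * shiftProd l L := by
  simp [shiftProd]

lemma shiftProd_semiconj {x L L' : E} (h : SemiconjBy x L L') (l : List F) :
    SemiconjBy x (shiftProd l L) (shiftProd l L') := by
  induction l with
  | nil => simp [shiftProd]
  | cons a l ih =>
    rw [shiftProd_cons, shiftProd_cons]
    exact (h.add_right ((Algebra.commutes a x).symm : _)).mul_right ih

lemma shiftProd_commute {L L' : E} (h : Commute L L') (l l' : List F) :
    Commute (shiftProd l L) (shiftProd l' L') := by
  have h1 : Commute L (shiftProd l' L') := shiftProd_semiconj h l'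
  exact (shiftProd_semiconj h1.symm l : Commute _ _).symm

lemma shiftProd_mul_shiftProd {L₁ L₂ M₁ M₂ : E} (h₁ : Commute L₁ M₂) (h₂ : Commute M₁ L₂)
    (hs : L₁ + M₂ = M₁ + L₂) (hp : L₁ * M₂ = M₁ * L₂) (l : List F) :
    shiftProd l L₁ * shiftProd l M₂ = shiftProd l M₁ * shiftProd l L₂ := by
  induction l with
  | nil => simp [shiftProd]
  | cons a l ih =>
    simp only [shiftProd_cons]
    have c : ∀ {L M : E}, Commute L M → Commute (shiftProd l L) (M + algebraMap F E a) :=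
      fun {L M} h => Commute.add_right (Commute.symm (shiftProd_semiconj h.symm l))
        (Algebra.commutes a _).symm
    have x : ∀ L M : E, (L + algebraMap F E a) * (M + algebraMap F E a)
        = L * M + (L + M) * algebraMap F E a + algebraMap F E a * algebraMap F E a := by
      intro L M
      simp only [mul_add, add_mul, Algebra.commutes a M]
      abel
    have e : (L₁ + algebraMap F E a) * (M₂ + algebraMap F E a)
        = (M₁ + algebraMap F E a) * (L₂ + algebraMap F E a) := by rw [x, x, hp, hs]
    calc _ = (L₁ + algebraMap F E a) * (shiftProd l L₁ * (M₂ + algebraMap F E a))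
          * shiftProd l M₂ := by simp only [mul_assoc]
      _ = ((L₁ + algebraMap F E a) * (M₂ + algebraMap F E a))
          * (shiftProd l L₁ * shiftProd l M₂) := by rw [(c h₁).eq]; simp only [mul_assoc]
      _ = (M₁ + algebraMap F E a) * ((L₂ + algebraMap F E a) * shiftProd l M₁)
          * shiftProd l L₂ := by rw [e, ih]; simp only [mul_assoc]
      _ = _ := by rw [← (c h₂).eq]; simp only [mul_assoc]

theorem commutator_shiftProd {L₁ L₂ Δ s t : E} (hst : Commute s t)
    (h₁ : L₁ * t = t * (L₁ + Δ)) (h₂ : L₂ * s = s * (L₂ + Δ))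
    (hΔ₁ : Δ * L₁ = L₂ * Δ) (hΔ₂ : Δ * L₂ = L₁ * Δ)
    (c₁ : Commute L₁ (L₂ + Δ)) (c₂ : Commute (L₁ + Δ) L₂) (l : List F) :
    t * (shiftProd l L₂ * (L₂ * (s * shiftProd l L₁)))
      - s * (shiftProd l L₁ * (t * (shiftProd l L₂ * L₂)))
      = s * (shiftProd l L₁ * (t * (Δ * shiftProd l L₁))) := by
  have e₁ : shiftProd l L₁ * t = t * shiftProd l (L₁ + Δ) :=
    (shiftProd_semiconj (show SemiconjBy t (L₁ + Δ) L₁ from h₁.symm) l).eq.symm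
  have e₂ : shiftProd l L₂ * s = s * shiftProd l (L₂ + Δ) :=
    (shiftProd_semiconj (show SemiconjBy s (L₂ + Δ) L₂ from h₂.symm) l).eq.symm
  have e₃ : Δ * shiftProd l L₁ = shiftProd l L₂ * Δ := (shiftProd_semiconj hΔ₁ l).eq
  have e₄ := shiftProd_mul_shiftProd c₁ c₂ (by abel)
    (by rw [mul_add, add_mul, hΔ₂]) l
  have e₅ : (L₂ + Δ) * shiftProd l L₁ = shiftProd l L₁ * (L₂ + Δ) :=
    (shiftProd_semiconj c₁.symm l).eq
  have e₆ : shiftProd l (L₂ + Δ) * shiftProd l L₁ = shiftProd l L₁ * shiftProd l (L₂ + Δ) :=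
    (shiftProd_commute c₁.symm l l).eq
  have a₁ : t * (shiftProd l L₂ * (L₂ * (s * shiftProd l L₁)))
      = s * t * (shiftProd l (L₁ + Δ) * (shiftProd l L₂ * (L₂ + Δ))) := by
    calc _ = t * (shiftProd l L₂ * ((L₂ * s) * shiftProd l L₁)) := by simp only [mul_assoc]
      _ = t * ((shiftProd l L₂ * s) * ((L₂ + Δ) * shiftProd l L₁)) := by
        rw [h₂]; simp only [mul_assoc]
      _ = t * s * ((shiftProd l (L₂ + Δ) * shiftProd l L₁) * (L₂ + Δ)) := by
        rw [e₂, e₅]; simp only [mul_assoc]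
      _ = _ := by rw [e₆, e₄, hst.eq]; simp only [mul_assoc]
  have a₂ : ∀ x, s * (shiftProd l L₁ * (t * x)) = s * t * (shiftProd l (L₁ + Δ) * x) := by
    intro x
    rw [← mul_assoc (shiftProd l L₁), e₁]; simp only [mul_assoc]
  rw [a₁, a₂, a₂, e₃, mul_add, mul_add, mul_add, add_sub_cancel_left]

theorem commute_of_components {X X' Y Y' N N' D D' σ h : E} {a b : F}
    (hXX : Commute X X') (hYY : Commute Y Y') (hNN : Commute N N')
    (hXN : Commute X N') (hNX : Commute N X') (hYN : Commute Y N') (hNY : Commute N Y')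
    (hh : h * h = b • h + algebraMap F E a)
    (hc : ∀ x ∈ [X, X', Y, Y', N, N', D, D', σ], Commute h x)
    (e₁ : X * (D + σ) - (D + σ) * X + (D' * X' - X' * D') = 0)
    (e₂ : Y * (D + σ) - (D + σ) * Y + (D' * Y' - Y' * D') = 0)
    (e₃ : N * (D + σ) - (D + σ) * N + (D' * N' - N' * D') + (D' * (D + σ) - (D + σ) * D') = 0)
    (e₄ : X * Y' - Y' * X + (Y * X' - X' * Y) + (D' * (D + σ) - (D + σ) * D') = 0) :
    Commute (a • X + Y + b • N + h * D') (a • X' + Y' + b • N' + h * D + h * σ) := by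
  simp only [List.mem_cons, List.not_mem_nil, or_false, forall_eq_or_imp, forall_eq] at hc
  obtain ⟨k1, k2, k3, k4, k5, k6, k7, k8, k9⟩ := hc
  rw [add_assoc _ (h * D), ← mul_add]
  have kD : Commute h (D + σ) := k7.add_right k9
  generalize D + σ = T at *
  have q : ∀ {x}, Commute h x → ∀ y, x * (h * y) = h * (x * y) := fun {x} hx y => by
    rw [← mul_assoc, ← hx.eq, mul_assoc]
  have q2 : ∀ y, h * (h * y) = b • (h * y) + a • y := fun y => by
    rw [← mul_assoc, hh, add_mul, smul_mul_assoc, Algebra.smul_def a]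
  rw [commute_iff_eq, ← sub_eq_zero]
  have := congr_arg₂ (· + ·) (congr_arg (fun x => a • (h * x)) e₁) (congr_arg (h * ·) e₂)
  have t2 := congr_arg₂ (· + ·) (congr_arg (fun x => b • (h * x)) e₃) (congr_arg (a • ·) e₄)
  have t3 := congr_arg₂ (· + ·) this t2
  simp only [mul_zero, smul_zero, add_zero] at t3
  rw [← t3]
  simp only [mul_add, add_mul, mul_sub, smul_mul_assoc, mul_smul_comm, mul_assoc, q k1, q k2, q k3,
    q k4, q k5, q k6, q k8, q kD, q2, hXX.eq, hYY.eq, hNN.eq, hXN.eq, hNX.eq, hYN.eq, hNY.eq]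
  module

lemma pow_bracket {E : Type*} [Ring E] {x y Z D ρ : E} (hxy : Commute x y)
    (h₁ : Z * x - x * Z = ρ) (h₂ : D * y - y * D = ρ) (h₃ : ρ * x = y * ρ)
    (h₄ : x * ρ = ρ * y) (k : ℕ) :
    x ^ k * Z - Z * x ^ k + (D * y ^ k - y ^ k * D) = 0 := by
  have e : ∀ k, D * y ^ (k + 1) - y ^ (k + 1) * D = (D * y ^ k - y ^ k * D) * y + y ^ k * ρ := by
    intro k
    rw [← h₂, pow_succ]; noncomm_ring
  have c : ∀ k, x * (D * y ^ k - y ^ k * D) = (D * y ^ k - y ^ k * D) * y := by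
    intro k
    induction k with
    | zero => simp
    | succ k ih =>
      rw [e, mul_add, ← mul_assoc, ih, ← mul_assoc, (hxy.pow_right k).eq, mul_assoc (y ^ k), h₄,
        add_mul, mul_assoc (y ^ k)]
  have d : ∀ k, ρ * x ^ k = y ^ k * ρ := fun k =>
    (show SemiconjBy ρ x y from h₃).pow_right k
  induction k with
  | zero => simp
  | succ k ih =>
    have t : x ^ (k + 1) * Z - Z * x ^ (k + 1) = x * (x ^ k * Z - Z * x ^ k)
        - (Z * x - x * Z) * x ^ k := by
      rw [pow_succ']; noncomm_ring
    rw [t, e, eq_neg_of_add_eq_zero_left ih, h₁, mul_neg, c, d]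
    abel

lemma smul_mul_bracket {h x x' Z W : E} (hZ : Commute h Z) (hW : Commute h W)
    (e : x * Z - Z * x + (W * x' - x' * W) = 0) (c : F) :
    (c • (h * x)) * Z - Z * (c • (h * x)) + (W * (c • (h * x')) - (c • (h * x')) * W) = 0 := by
  simp only [smul_mul_assoc, mul_smul_comm, ← smul_sub, ← smul_add]
  rw [← mul_assoc Z, ← hZ.eq, ← mul_assoc W, ← hW.eq]
  simp only [mul_assoc, ← mul_sub, ← mul_add]
  rw [e, mul_zero, smul_zero]
end alg

section sums
open Filter
variable {F M M' M'' : Type*} [Field F] [AddCommGroup M] [Module F M] [AddCommGroup M']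
  [Module F M'] [AddCommGroup M''] [Module F M'']

/-- `T` is the locally finite sum of the linear maps `φ i`. -/
def HasLocSum (φ : ℕ → M →ₗ[F] M') (T : M →ₗ[F] M') : Prop :=
  ∀ v, ∀ᶠ n in atTop, ∑ i ∈ Finset.range n, φ i v = T v

namespace HasLocSum
variable {φ ψ : ℕ → M →ₗ[F] M'} {T U : M →ₗ[F] M'}

lemma unique (h : HasLocSum φ T) (h' : HasLocSum φ U) : T = U := by
  ext v
  obtain ⟨n, a, b⟩ := ((h v).and (h' v)).exists
  rw [← a, b]

lemma congr (h : HasLocSum φ T) (e : ∀ i, φ i = ψ i) : HasLocSum ψ T := by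
  rwa [← funext e]

lemma add (h : HasLocSum φ T) (h' : HasLocSum ψ U) : HasLocSum (fun i => φ i + ψ i) (T + U) := by
  intro v
  filter_upwards [h v, h' v] with n a b
  simp [Finset.sum_add_distrib, a, b]

lemma sub (h : HasLocSum φ T) (h' : HasLocSum ψ U) : HasLocSum (fun i => φ i - ψ i) (T - U) := by
  intro v
  filter_upwards [h v, h' v] with n a b
  simp [Finset.sum_sub_distrib, a, b]

lemma comp_left (h : HasLocSum φ T) (A : M' →ₗ[F] M'') :
    HasLocSum (fun i => A ∘ₗ φ i) (A ∘ₗ T) := by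
  intro v
  filter_upwards [h v] with n a
  simp [← a]

lemma comp_right (h : HasLocSum φ T) (A : M'' →ₗ[F] M) :
    HasLocSum (fun i => φ i ∘ₗ A) (T ∘ₗ A) := by
  intro v
  filter_upwards [h (A v)] with n a
  simp [← a]

lemma mul_left {φ : ℕ → Module.End F M} {T : Module.End F M} (h : HasLocSum φ T)
    (A : Module.End F M) : HasLocSum (fun i => A * φ i) (A * T) := h.comp_left A

lemma mul_right {φ : ℕ → Module.End F M} {T : Module.End F M} (h : HasLocSum φ T)
    (A : Module.End F M) : HasLocSum (fun i => φ i * A) (T * A) := h.comp_right A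

lemma zero : HasLocSum (fun _ => 0 : ℕ → M →ₗ[F] M') 0 := by
  intro v; simp

lemma single (k : ℕ) (A : M →ₗ[F] M') : HasLocSum (fun i => if i = k then A else 0) A := by
  intro v
  filter_upwards [eventually_gt_atTop k] with n hn
  rw [Finset.sum_eq_single k]
  · simp
  · intro i _ hi; simp [hi]
  · intro hk; exact absurd (Finset.mem_range.2 hn) hk

lemma commute {φ : ℕ → Module.End F M} {T A : Module.End F M} (h : HasLocSum φ T)
    (hA : ∀ i, Commute A (φ i)) : Commute A T :=
  (h.mul_left A).unique ((h.mul_right A).congr fun i => (hA i).eq.symm)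

lemma of_finsupp {ι : Type*} {B : Type*} [AddCommGroup B] [Module F B]
    {φ : ℕ → (ι →₀ B) →ₗ[F] M'} {T : (ι →₀ B) →ₗ[F] M'}
    (h : ∀ x b, ∀ᶠ n in atTop, ∑ i ∈ Finset.range n, φ i (Finsupp.single x b)
      = T (Finsupp.single x b)) : HasLocSum φ T := by
  intro v
  induction v using Finsupp.induction_linear with
  | zero => simp
  | add f g hf hg =>
    filter_upwards [hf, hg] with n a b
    simp [Finset.sum_add_distrib, a, b]
  | single x b => exact h x b

lemma exists_of_eventually (h : ∀ v, ∀ᶠ i in atTop, φ i v = 0) : ∃ T, HasLocSum φ T := by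
  have key : ∀ v, ∃ w, ∀ᶠ n in atTop, ∑ i ∈ Finset.range n, φ i v = w := by
    intro v
    obtain ⟨N, hN⟩ := eventually_atTop.1 (h v)
    refine ⟨∑ i ∈ Finset.range N, φ i v, ?_⟩
    filter_upwards [eventually_ge_atTop N] with n hn
    symm
    refine Finset.sum_subset (Finset.range_subset_range.2 hn) fun i _ hi => hN i ?_
    simpa using hi
  choose T hT using key
  refine ⟨⟨⟨T, fun v w => ?_⟩, fun c v => ?_⟩, hT⟩
  · obtain ⟨n, a, b, c⟩ := ((hT (v + w)).and ((hT v).and (hT w))).exists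
    rw [← a, ← b, ← c]; simp [Finset.sum_add_distrib]
  · obtain ⟨n, a, b⟩ := ((hT (c • v)).and (hT v)).exists
    simp only [RingHom.id_apply]
    rw [← a, ← b]; simp [Finset.smul_sum]

end HasLocSum
end sums

section model
open Filter
open Finsupp
variable {F B : Type*} [Field F] [AddCommGroup B] [Module F B]

variable (F B) in
/-- Multiplication by `s` on `B[s, t]`. -/
def sMul : Module.End F (ℕ × ℕ →₀ B) := lsum F fun x => lsingle (x.1 + 1, x.2)

variable (F B) in
/-- The backward shift `f ↦ (f - f|_{s = 0}) / s` on `B[s, t]`. -/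
def sDiv : Module.End F (ℕ × ℕ →₀ B) :=
  lsum F fun x => if x.1 = 0 then 0 else lsingle (x.1 - 1, x.2)

variable (F B) in
/-- The Euler operator `s ∂/∂s` on `B[s, t]`. -/
def sEuler : Module.End F (ℕ × ℕ →₀ B) := lsum F fun x => (x.1 : F) • lsingle x

variable (F B) in
/-- The exchange of `s` and `t` on `B[s, t]`. -/
def swapST : Module.End F (ℕ × ℕ →₀ B) := lsum F fun x => lsingle x.swap

variable (F B) in
/-- The divided difference `f ↦ s (f(s, s) - f(t, s)) / (s - t)` on `B[s, t]`. -/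
def divDiff : Module.End F (ℕ × ℕ →₀ B) :=
  lsum F fun x => ∑ i ∈ Finset.range x.1, lsingle (x.2 + i + 1, x.1 - 1 - i)

/-- An operator on coefficients, extended to `B[s, t]`. -/
def coeffMap (φ : Module.End F B) : Module.End F (ℕ × ℕ →₀ B) := mapRange.linearMap φ

/-- Conjugation by the exchange of `s` and `t`. -/
def conjST (T : Module.End F (ℕ × ℕ →₀ B)) : Module.End F (ℕ × ℕ →₀ B) :=
  swapST F B * T * swapST F B

@[simp] lemma sMul_single (m n : ℕ) (b : B) :
    sMul F B (single (m, n) b) = single (m + 1, n) b := by simp [sMul]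

@[simp] lemma sDiv_single_zero (n : ℕ) (b : B) : sDiv F B (single (0, n) b) = 0 := by simp [sDiv]

@[simp] lemma sDiv_single_succ (m n : ℕ) (b : B) :
    sDiv F B (single (m + 1, n) b) = single (m, n) b := by simp [sDiv]

@[simp] lemma sEuler_single (m n : ℕ) (b : B) :
    sEuler F B (single (m, n) b) = (m : F) • single (m, n) b := by simp [sEuler]

@[simp] lemma swapST_single (m n : ℕ) (b : B) :
    swapST F B (single (m, n) b) = single (n, m) b := by simp [swapST]

@[simp] lemma divDiff_single (m n : ℕ) (b : B) :
    divDiff F B (single (m, n) b)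
      = ∑ i ∈ Finset.range m, single (n + i + 1, m - 1 - i) b := by simp [divDiff]

@[simp] lemma coeffMap_single (φ : Module.End F B) (x : ℕ × ℕ) (b : B) :
    coeffMap φ (single x b) = single x (φ b) := by simp [coeffMap]

lemma model_ext {T U : Module.End F (ℕ × ℕ →₀ B)}
    (h : ∀ m n b, T (single (m, n) b) = U (single (m, n) b)) : T = U :=
  lhom_ext fun x b => h x.1 x.2 b

@[simp] lemma swapST_mul_self : swapST F B * swapST F B = 1 := model_ext fun m n b => by simp

lemma swapST_mul_swapST_mul (T : Module.End F (ℕ × ℕ →₀ B)) :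
    swapST F B * (swapST F B * T) = T := by rw [← mul_assoc]; simp

lemma conjST_mul (T U : Module.End F (ℕ × ℕ →₀ B)) :
    conjST (T * U) = conjST T * conjST U := by
  simp only [conjST, mul_assoc, swapST_mul_swapST_mul]

@[simp] lemma conjST_add (T U : Module.End F (ℕ × ℕ →₀ B)) :
    conjST (T + U) = conjST T + conjST U := by simp only [conjST, mul_add, add_mul]

@[simp] lemma conjST_sub (T U : Module.End F (ℕ × ℕ →₀ B)) :
    conjST (T - U) = conjST T - conjST U := by simp only [conjST, mul_sub, sub_mul]

@[simp] lemma conjST_smul (c : F) (T : Module.End F (ℕ × ℕ →₀ B)) :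
    conjST (c • T) = c • conjST T := by simp [conjST]

@[simp] lemma conjST_conjST (T : Module.End F (ℕ × ℕ →₀ B)) : conjST (conjST T) = T := by
  simp only [conjST, mul_assoc, swapST_mul_swapST_mul, swapST_mul_self, mul_one]

@[simp] lemma conjST_swapST : conjST (swapST F B) = swapST F B := by
  rw [conjST, swapST_mul_self, one_mul]

lemma conjST_pow (T : Module.End F (ℕ × ℕ →₀ B)) (k : ℕ) :
    conjST (T ^ k) = conjST T ^ k := by
  induction k with
  | zero => simp [conjST]
  | succ k ih => rw [pow_succ, conjST_mul, ih, pow_succ]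

@[simp] lemma conjST_coeffMap (φ : Module.End F B) : conjST (coeffMap φ) = coeffMap φ :=
  model_ext fun m n b => by simp [conjST]

lemma swapST_mul_eq (T : Module.End F (ℕ × ℕ →₀ B)) :
    swapST F B * T = conjST T * swapST F B := by simp [conjST, mul_assoc]

lemma mul_swapST_eq (T : Module.End F (ℕ × ℕ →₀ B)) :
    T * swapST F B = swapST F B * conjST T := by
  simp [conjST, mul_assoc, swapST_mul_swapST_mul]

lemma conjST_single (T : Module.End F (ℕ × ℕ →₀ B)) (m n : ℕ) (b : B) :
    conjST T (single (m, n) b) = swapST F B (T (single (n, m) b)) := by simp [conjST]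

lemma coeffMap_mul (φ ψ : Module.End F B) : coeffMap (φ * ψ) = coeffMap φ * coeffMap ψ :=
  model_ext fun m n b => by simp

lemma coeffMap_commute_sMul (φ : Module.End F B) : Commute (coeffMap φ) (sMul F B) :=
  model_ext fun m n b => by simp

lemma coeffMap_commute_sDiv (φ : Module.End F B) : Commute (coeffMap φ) (sDiv F B) :=
  model_ext fun m n b => by cases m <;> simp

lemma coeffMap_commute_sEuler (φ : Module.End F B) : Commute (coeffMap φ) (sEuler F B) :=
  model_ext fun m n b => by simp

lemma coeffMap_commute_swapST (φ : Module.End F B) : Commute (coeffMap φ) (swapST F B) :=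
  model_ext fun m n b => by simp

lemma coeffMap_commute_divDiff (φ : Module.End F B) : Commute (coeffMap φ) (divDiff F B) :=
  model_ext fun m n b => by simp [map_sum]

lemma Commute.conjST {T U : Module.End F (ℕ × ℕ →₀ B)} (h : Commute T U) :
    Commute (conjST T) (conjST U) := by
  rw [commute_iff_eq, ← conjST_mul, h.eq, conjST_mul]

lemma coeffMap_commute_conjST {φ : Module.End F B} {T : Module.End F (ℕ × ℕ →₀ B)}
    (h : Commute (coeffMap φ) T) : Commute (coeffMap φ) (conjST T) := by
  simpa using Commute.conjST h

lemma sMul_commute_conj_sMul : Commute (sMul F B) (conjST (sMul F B)) :=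
  model_ext fun m n b => by simp [conjST]

lemma sMul_commute_conj_sDiv : Commute (sMul F B) (conjST (sDiv F B)) :=
  model_ext fun m n b => by cases n <;> simp [conjST]

lemma sDiv_commute_conj_sDiv : Commute (sDiv F B) (conjST (sDiv F B)) :=
  model_ext fun m n b => by cases m <;> cases n <;> simp [conjST]

lemma sMul_commute_conj_sEuler : Commute (sMul F B) (conjST (sEuler F B)) :=
  model_ext fun m n b => by simp [conjST]

lemma sDiv_commute_conj_sEuler : Commute (sDiv F B) (conjST (sEuler F B)) :=
  model_ext fun m n b => by cases m <;> simp [conjST]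

lemma sEuler_commute_conj_sEuler : Commute (sEuler F B) (conjST (sEuler F B)) :=
  model_ext fun m n b => by simp [conjST, smul_smul, mul_comm]

lemma divDiff_mul_sMul :
    divDiff F B * sMul F B = sMul F B * divDiff F B + sMul F B * swapST F B :=
  model_ext fun m n b => by
    simp only [Module.End.mul_apply, sMul_single, divDiff_single, LinearMap.add_apply, map_sum,
      swapST_single]
    rw [Finset.sum_range_succ']
    congr 1
    refine Finset.sum_congr rfl fun i hi => ?_
    congr 2; all_goals omega

lemma sDiv_mul_divDiff :
    sDiv F B * divDiff F B = divDiff F B * sDiv F B + swapST F B * sDiv F B :=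
  model_ext fun m n b => by
    cases m with
    | zero => simp
    | succ m =>
      simp only [Module.End.mul_apply, sDiv_single_succ, divDiff_single, LinearMap.add_apply,
        map_sum, swapST_single]
      rw [Finset.sum_range_succ']
      congr 1
      refine Finset.sum_congr rfl fun i hi => ?_
      congr 2; all_goals omega

lemma conj_divDiff_mul_sMul :
    conjST (divDiff F B) * sMul F B = conjST (sMul F B) * conjST (divDiff F B) :=
  model_ext fun m n b => by
    simp only [Module.End.mul_apply, sMul_single, conjST_single, divDiff_single, map_sum,
      swapST_single]
    refine Finset.sum_congr rfl fun i hi => ?_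
    congr 2; omega

lemma pow_sMul_bracket (k : ℕ) :
    sMul F B ^ k * (divDiff F B + swapST F B) - (divDiff F B + swapST F B) * sMul F B ^ k
      + (conjST (divDiff F B) * conjST (sMul F B) ^ k
        - conjST (sMul F B) ^ k * conjST (divDiff F B)) = 0 := by
  have e := congrArg conjST (divDiff_mul_sMul (F := F) (B := B))
  simp only [conjST_mul, conjST_add, conjST_swapST] at e
  refine pow_bracket (ρ := swapST F B * sMul F B) sMul_commute_conj_sMul ?_ ?_ ?_ ?_ k
  · rw [mul_add, add_mul, divDiff_mul_sMul]; abel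
  · rw [e, swapST_mul_eq]; abel
  · rw [swapST_mul_eq, mul_assoc]
    rw [swapST_mul_eq]
  · rw [← mul_assoc, mul_swapST_eq, mul_assoc, mul_assoc, sMul_commute_conj_sMul.eq]

lemma pow_sDiv_bracket (k : ℕ) :
    sDiv F B ^ k * (divDiff F B + swapST F B) - (divDiff F B + swapST F B) * sDiv F B ^ k
      + (conjST (divDiff F B) * conjST (sDiv F B) ^ k
        - conjST (sDiv F B) ^ k * conjST (divDiff F B)) = 0 := by
  have e := congrArg conjST (sDiv_mul_divDiff (F := F) (B := B))
  simp only [conjST_mul, conjST_add, conjST_swapST] at e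
  refine pow_bracket (ρ := 0 - sDiv F B * swapST F B) sDiv_commute_conj_sDiv ?_ ?_ ?_ ?_ k
  · rw [mul_add, add_mul, sDiv_mul_divDiff]; abel
  · rw [e, mul_swapST_eq]; abel
  · rw [sub_mul, zero_mul, mul_sub, mul_zero, mul_assoc, swapST_mul_eq, ← mul_assoc, ← mul_assoc,
      sDiv_commute_conj_sDiv.eq]
  · rw [sub_mul, zero_mul, mul_sub, mul_zero, mul_assoc, ← mul_swapST_eq]

variable (F B) in
/-- The operator `f ↦ ∑ j t ^ j (sDiv ^ j) f`, written through the divided difference. -/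
def weightedShift : Module.End F (ℕ × ℕ →₀ B) :=
  conjST (divDiff F B) * divDiff F B + swapST F B * divDiff F B

lemma weightedShift_mul_sMul : weightedShift F B * sMul F B
    = conjST (sMul F B) * (weightedShift F B + 1 + swapST F B * divDiff F B) := by
  have e := congrArg conjST (conj_divDiff_mul_sMul (F := F) (B := B))
  have q : conjST (divDiff F B) * (sMul F B * swapST F B)
      = conjST (sMul F B) * (swapST F B * divDiff F B) := by
    rw [← mul_assoc, conj_divDiff_mul_sMul, mul_assoc, swapST_mul_eq]
  have q' : swapST F B * (sMul F B * swapST F B) = conjST (sMul F B) := by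
    rw [conjST, mul_assoc]
  rw [weightedShift, add_mul, mul_assoc, mul_assoc, divDiff_mul_sMul, mul_add, mul_add, q, q',
    ← mul_assoc, conj_divDiff_mul_sMul, ← mul_assoc (swapST F B), swapST_mul_eq (sMul F B)]
  simp only [mul_add, mul_one, mul_assoc]
  abel

lemma weightedShift_single (m n : ℕ) (b : B) : weightedShift F B (single (m, n) b)
    = ∑ j ∈ Finset.range m, (j + 1 : F) • single (m - 1 - j, n + j + 1) b := by
  induction m with
  | zero => simp [weightedShift]
  | succ m ih =>
    have := LinearMap.congr_fun (weightedShift_mul_sMul (F := F) (B := B)) (single (m, n) b)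
    simp only [Module.End.mul_apply, LinearMap.add_apply, ih, sMul_single, Module.End.one_apply,
      map_add, map_sum, divDiff_single, conjST_single, swapST_single, map_smul] at this
    rw [this, Finset.sum_range_succ', add_right_comm, ← Finset.sum_add_distrib]
    congr 1
    · refine Finset.sum_congr rfl fun j hj => ?_
      have h1 : m + 1 - 1 - (j + 1) = m - 1 - j := by omega
      have h2 : n + (j + 1) + 1 = n + j + 1 + 1 := by omega
      rw [h1, h2]
      push_cast
      module
    · simp

lemma sDiv_pow_single (k m n : ℕ) (b : B) : (sDiv F B ^ k) (single (m, n) b)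
    = if k ≤ m then single (m - k, n) b else 0 := by
  induction k generalizing m with
  | zero => simp
  | succ k ih =>
    rw [pow_succ, Module.End.mul_apply]
    cases m with
    | zero => simp
    | succ m => rw [sDiv_single_succ, ih]; simp

lemma sMul_pow_single (k m n : ℕ) (b : B) : (sMul F B ^ k) (single (m, n) b)
    = single (m + k, n) b := by
  induction k generalizing m with
  | zero => simp
  | succ k ih =>
    rw [pow_succ, Module.End.mul_apply, sMul_single, ih]
    congr 2; omega

lemma hasLocSum_weightedShift : HasLocSum
    (fun j => (j + 1 : F) • (conjST (sMul F B) ^ (j + 1) * sDiv F B ^ (j + 1)))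
    (weightedShift F B) := by
  refine HasLocSum.of_finsupp fun ⟨m, n⟩ b => ?_
  filter_upwards [eventually_ge_atTop m] with N hN
  rw [weightedShift_single]
  symm
  refine (Finset.sum_congr rfl fun j hj => ?_).trans
    (Finset.sum_subset (Finset.range_subset_range.2 hN) fun j _ hj => ?_)
  · have : j + 1 ≤ m := by simpa using hj
    rw [LinearMap.smul_apply, Module.End.mul_apply, sDiv_pow_single, if_pos this, ← conjST_pow,
      conjST_single, sMul_pow_single, swapST_single]
    congr 3
    omega
  · have : ¬ j + 1 ≤ m := by simpa using hj
    rw [LinearMap.smul_apply, Module.End.mul_apply, sDiv_pow_single, if_neg this]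
    simp

lemma weightedShift_sub_conj : weightedShift F B - conjST (weightedShift F B)
    = conjST (divDiff F B) * (divDiff F B + swapST F B)
      - (divDiff F B + swapST F B) * conjST (divDiff F B) := by
  have q : conjST (swapST F B * divDiff F B) = divDiff F B * swapST F B := by
    rw [conjST_mul, conjST_swapST, mul_swapST_eq]
  have q' : conjST (divDiff F B) * swapST F B = swapST F B * divDiff F B := by
    rw [swapST_mul_eq]
  rw [weightedShift, conjST_add, q, conjST_mul, conjST_conjST, mul_add, add_mul, q', mul_swapST_eq]

lemma sEuler_bracket :
    sEuler F B * (divDiff F B + swapST F B) - (divDiff F B + swapST F B) * sEuler F B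
      + (conjST (divDiff F B) * conjST (sEuler F B) - conjST (sEuler F B) * conjST (divDiff F B))
      + (conjST (divDiff F B) * (divDiff F B + swapST F B)
        - (divDiff F B + swapST F B) * conjST (divDiff F B)) = 0 := by
  rw [← weightedShift_sub_conj]
  refine model_ext fun m n b => ?_
  simp only [Module.End.mul_apply, LinearMap.add_apply, LinearMap.sub_apply, weightedShift_single,
    conjST_single, divDiff_single, swapST_single, sEuler_single, map_add, map_sum, map_smul,
    LinearMap.zero_apply]
  set f : ℕ → (ℕ × ℕ →₀ B) := fun a => single (a, m + n - a) b with hf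
  have split : ∀ (p q : ℕ) (g : ℕ → (ℕ × ℕ →₀ B)), ∑ a ∈ Finset.range (p + (q + 1)), g a
      = ∑ i ∈ Finset.range q, g (p + (i + 1)) + g p + ∑ i ∈ Finset.range p, g (p - 1 - i) := by
    intro p q g
    rw [Finset.sum_range_add, Finset.sum_range_succ', Finset.sum_range_reflect g p]
    simp [add_comm]
  have key := (split n m fun a => ((a : F) - m) • f a).symm.trans
    ((congrArg (fun N => ∑ a ∈ Finset.range N, ((a : F) - m) • f a) (by omega)).trans
      (split m n fun a => ((a : F) - m) • f a))
  have g₀ : single (n, m) b = f n := by simp [hf]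
  have g₁ : ∀ i ∈ Finset.range m, (single (n + i + 1, m - 1 - i) b : ℕ × ℕ →₀ B)
      = f (n + (i + 1)) := by
    intro i hi
    simp only [Finset.mem_range] at hi
    simp only [hf]; congr 2; omega
  have g₂ : ∀ i ∈ Finset.range n, (single (n - 1 - i, m + i + 1) b : ℕ × ℕ →₀ B)
      = f (n - 1 - i) := by
    intro i hi
    simp only [Finset.mem_range] at hi
    simp only [hf]; congr 2; omega
  have g₃ : ∀ i ∈ Finset.range n, (single (m + i + 1, n - 1 - i) b : ℕ × ℕ →₀ B)
      = f (m + (i + 1)) := by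
    intro i hi
    simp only [Finset.mem_range] at hi
    simp only [hf]; congr 2; omega
  have g₄ : ∀ i ∈ Finset.range m, (single (m - 1 - i, n + i + 1) b : ℕ × ℕ →₀ B)
      = f (m - 1 - i) := by
    intro i hi
    simp only [Finset.mem_range] at hi
    simp only [hf]; congr 2; omega
  have c₂ : ∀ i ∈ Finset.range n, (((n - 1 - i : ℕ) : F) - m) • f (n - 1 - i)
      = (n : F) • f (n - 1 - i) - ((m + i + 1 : ℕ) : F) • f (n - 1 - i) := by
    intro i hi
    simp only [Finset.mem_range] at hi
    have : ((n - 1 - i : ℕ) : F) = n - 1 - i := by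
      rw [Nat.cast_sub (by omega), Nat.cast_sub (by omega)]; simp
    rw [this]; push_cast; module
  have c₄ : ∀ i ∈ Finset.range m, (((m - 1 - i : ℕ) : F) - m) • f (m - 1 - i)
      = -((i + 1 : F) • f (m - 1 - i)) := by
    intro i hi
    simp only [Finset.mem_range] at hi
    have : ((m - 1 - i : ℕ) : F) = m - 1 - i := by
      rw [Nat.cast_sub (by omega), Nat.cast_sub (by omega)]; simp
    rw [this]; module
  rw [Finset.sum_congr rfl c₂, Finset.sum_congr rfl c₄] at key
  simp only [sub_self, zero_smul, add_zero, Finset.sum_sub_distrib, Finset.sum_neg_distrib,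
    Nat.cast_add, Nat.cast_one, sub_smul, add_smul, one_smul, ← Finset.smul_sum,
    Finset.sum_add_distrib, add_sub_cancel_left] at key
  simp only [g₀]
  rw [Finset.sum_congr rfl g₁, Finset.sum_congr rfl g₂,
    Finset.sum_congr rfl fun i hi => congrArg (((n + i + 1 : ℕ) : F) • ·) (g₁ i hi),
    Finset.sum_congr rfl fun i hi => congrArg (((m + i + 1 : ℕ) : F) • ·) (g₂ i hi),
    Finset.sum_congr rfl fun (i : ℕ) hi => congrArg (((i : F) + 1) • ·) (g₃ i hi),
    Finset.sum_congr rfl fun (i : ℕ) hi => congrArg (((i : F) + 1) • ·) (g₄ i hi)]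
  simp only [smul_add, Nat.cast_add, Nat.cast_one, add_smul, one_smul, ← Finset.smul_sum,
    Finset.sum_add_distrib]
  rw [← sub_eq_zero] at key
  rw [← key]
  module

lemma HasLocSum.conjST {φ : ℕ → Module.End F (ℕ × ℕ →₀ B)} {T : Module.End F (ℕ × ℕ →₀ B)}
    (h : HasLocSum φ T) : HasLocSum (fun i => _root_.conjST (φ i)) (_root_.conjST T) :=
  (h.mul_left (swapST F B)).mul_right (swapST F B)

lemma HasLocSum.bracket_eq_zero {φ : ℕ → Module.End F (ℕ × ℕ →₀ B)}
    {T Z W : Module.End F (ℕ × ℕ →₀ B)} (h : HasLocSum φ T)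
    (h₀ : ∀ i, φ i * Z - Z * φ i + (W * _root_.conjST (φ i) - _root_.conjST (φ i) * W) = 0) :
    T * Z - Z * T + (W * _root_.conjST T - _root_.conjST T * W) = 0 :=
  ((((h.mul_right Z).sub (h.mul_left Z)).add
    ((h.conjST.mul_left W).sub (h.conjST.mul_right W))).congr h₀).unique HasLocSum.zero

lemma smul_coeffMap_bracket {φ : Module.End F B} {c : F} {x Z W : Module.End F (ℕ × ℕ →₀ B)}
    (hZ : Commute (coeffMap φ) Z) (hW : Commute (coeffMap φ) W)
    (h : x * Z - Z * x + (W * conjST x - conjST x * W) = 0) :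
    (c • (coeffMap φ * x)) * Z - Z * (c • (coeffMap φ * x))
      + (W * conjST (c • (coeffMap φ * x)) - conjST (c • (coeffMap φ * x)) * W) = 0 := by
  rw [conjST_smul, conjST_mul, conjST_coeffMap]
  exact smul_mul_bracket hZ hW h c

lemma HasLocSum.commute_term {q : ℕ → Module.End F B} {c : ℕ → F}
    {A S N : Module.End F (ℕ × ℕ →₀ B)}
    (hS : HasLocSum (fun i => c i • (coeffMap (q i) * A ^ (i + 1))) S)
    (hq : ∀ i, Commute (coeffMap (q i)) N) (hA : Commute A N) : Commute S N :=
  Commute.symm <| hS.commute fun i =>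
    ((hq i).symm.mul_right (hA.symm.pow_right (i + 1))).smul_right (c i)

lemma HasLocSum.conj_term {q : ℕ → Module.End F B} {c : ℕ → F}
    {A S : Module.End F (ℕ × ℕ →₀ B)}
    (hS : HasLocSum (fun i => c i • (coeffMap (q i) * A ^ (i + 1))) S) :
    HasLocSum (fun i => c i • (coeffMap (q i) * _root_.conjST A ^ (i + 1))) (_root_.conjST S) :=
  hS.conjST.congr fun i => by rw [conjST_smul, conjST_mul, conjST_coeffMap, conjST_pow]

lemma HasLocSum.commute_conjST {q : ℕ → Module.End F B} {c : ℕ → F}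
    {A S : Module.End F (ℕ × ℕ →₀ B)}
    (hS : HasLocSum (fun i => c i • (coeffMap (q i) * A ^ (i + 1))) S)
    (hq : ∀ i j, Commute (q i) (q j)) (hqA : ∀ i, Commute (coeffMap (q i)) A)
    (hA : Commute A (_root_.conjST A)) : Commute S (_root_.conjST S) :=
  hS.commute_term
    (fun i => (hS.conj_term.commute_term
      (fun j => by rw [commute_iff_eq, ← coeffMap_mul, (hq j i).eq, coeffMap_mul])
      (coeffMap_commute_conjST (hqA i)).symm).symm)
    (hS.conj_term.commute_term (fun j => hqA j) hA.symm).symm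

section operators
variable {p d : ℕ → Module.End F B} {X Y : Module.End F (ℕ × ℕ →₀ B)} {h : Module.End F B}
  {a b : F}

lemma annihilation_creation_bracket
    (hX : HasLocSum (fun i => (i + 1 : F) • (coeffMap (d i) * sMul F B ^ (i + 1))) X)
    (hY : HasLocSum (fun i => (1 : F) • (coeffMap (p i) * sDiv F B ^ (i + 1))) Y)
    (hdp : ∀ i j, d i * p j - p j * d i = if j = i then 1 else 0) :
    X * conjST Y - conjST Y * X = conjST (weightedShift F B) := by
  refine HasLocSum.unique (((hX.mul_right (conjST Y)).sub (hX.mul_left (conjST Y))).congr ?_)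
    (hasLocSum_weightedShift.conjST)
  intro i
  refine HasLocSum.unique (((hY.conjST.mul_left _).sub (hY.conjST.mul_right _)).congr ?_)
    (HasLocSum.single i _)
  intro j
  have c₁ := (coeffMap_commute_sMul (p j)).pow_right (i + 1)
  have c₂ := (coeffMap_commute_conjST (coeffMap_commute_sDiv (d i))).pow_right (j + 1)
  have c₃ := (sMul_commute_conj_sDiv (F := F) (B := B)).pow_pow (i + 1) (j + 1)
  have e : coeffMap (d i) * coeffMap (p j) = coeffMap (p j) * coeffMap (d i)
      + if j = i then 1 else 0 := by
    have := congrArg coeffMap (sub_eq_iff_eq_add'.1 (hdp i j))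
    rw [coeffMap_mul] at this
    rw [this, ← coeffMap_mul]
    refine model_ext fun m n b => ?_
    split_ifs <;> simp
  rw [one_smul, conjST_mul, conjST_pow, conjST_coeffMap, smul_mul_assoc, mul_smul_comm]
  have l : coeffMap (d i) * sMul F B ^ (i + 1) * (coeffMap (p j) * conjST (sDiv F B) ^ (j + 1))
      = (coeffMap (d i) * coeffMap (p j)) * (sMul F B ^ (i + 1) * conjST (sDiv F B) ^ (j + 1)) := by
    rw [mul_assoc, ← mul_assoc (sMul F B ^ (i + 1)), ← c₁.eq]; simp only [mul_assoc]
  have r : coeffMap (p j) * conjST (sDiv F B) ^ (j + 1) * (coeffMap (d i) * sMul F B ^ (i + 1))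
      = (coeffMap (p j) * coeffMap (d i)) * (sMul F B ^ (i + 1) * conjST (sDiv F B) ^ (j + 1)) := by
    rw [mul_assoc, ← mul_assoc (conjST (sDiv F B) ^ (j + 1)), ← c₂.eq, c₃.eq]
    simp only [mul_assoc]
  rw [l, r, e, add_mul, smul_add, add_sub_cancel_left]
  split_ifs with hij
  · subst hij
    rw [one_mul, conjST_smul, conjST_mul, conjST_pow, conjST_pow, conjST_conjST]
  · simp

theorem laplaceBeltrami_commute
    (hX : HasLocSum (fun i => (i + 1 : F) • (coeffMap (d i) * sMul F B ^ (i + 1))) X)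
    (hY : HasLocSum (fun i => (1 : F) • (coeffMap (p i) * sDiv F B ^ (i + 1))) Y)
    (hdp : ∀ i j, d i * p j - p j * d i = if j = i then 1 else 0)
    (hdd : ∀ i j, Commute (d i) (d j)) (hpp : ∀ i j, Commute (p i) (p j))
    (hhd : ∀ i, Commute h (d i)) (hhp : ∀ i, Commute h (p i))
    (hh : h * h = b • h + algebraMap F _ a) :
    Commute (a • X + Y + b • sEuler F B + coeffMap h * conjST (divDiff F B))
      (a • conjST X + conjST Y + b • conjST (sEuler F B) + coeffMap h * divDiff F B
        + coeffMap h * swapST F B) := by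
  have cc : ∀ {φ ψ : Module.End F B}, Commute φ ψ → Commute (coeffMap φ) (coeffMap ψ) := by
    intro φ ψ hc
    rw [commute_iff_eq, ← coeffMap_mul, hc.eq, coeffMap_mul]
  have cX : Commute (coeffMap h) X := hX.commute fun i =>
    ((cc (hhd i)).mul_right ((coeffMap_commute_sMul h).pow_right _)).smul_right _
  have cY : Commute (coeffMap h) Y := hY.commute fun i =>
    ((cc (hhp i)).mul_right ((coeffMap_commute_sDiv h).pow_right _)).smul_right _
  have cT : ∀ φ : Module.End F B, Commute (coeffMap φ) (divDiff F B + swapST F B) := fun φ =>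
    (coeffMap_commute_divDiff φ).add_right (coeffMap_commute_swapST φ)
  have cD : ∀ φ : Module.End F B, Commute (coeffMap φ) (conjST (divDiff F B)) := fun φ =>
    coeffMap_commute_conjST (coeffMap_commute_divDiff φ)
  have e₄ := annihilation_creation_bracket hX hY hdp
  have sN := Commute.conjST (sMul_commute_conj_sEuler (F := F) (B := B))
  have dN := Commute.conjST (sDiv_commute_conj_sEuler (F := F) (B := B))
  rw [conjST_conjST] at sN dN
  refine commute_of_components
    (hX.commute_conjST hdd (fun i => coeffMap_commute_sMul _) sMul_commute_conj_sMul)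
    (hY.commute_conjST hpp (fun i => coeffMap_commute_sDiv _) sDiv_commute_conj_sDiv)
    sEuler_commute_conj_sEuler
    (hX.commute_term (fun i => coeffMap_commute_conjST (coeffMap_commute_sEuler _))
      sMul_commute_conj_sEuler)
    (hX.conj_term.commute_term (fun i => coeffMap_commute_sEuler _) sN).symm
    (hY.commute_term (fun i => coeffMap_commute_conjST (coeffMap_commute_sEuler _))
      sDiv_commute_conj_sEuler)
    (hY.conj_term.commute_term (fun i => coeffMap_commute_sEuler _) dN).symm
    ?_ ?_ ?_ ?_ sEuler_bracket ?_
  · rw [← coeffMap_mul, hh]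
    refine model_ext fun m n c => ?_
    simp [Finsupp.single_add, Algebra.algebraMap_eq_smul_one]
  · simp only [List.mem_cons, List.not_mem_nil, or_false, forall_eq_or_imp, forall_eq]
    exact ⟨cX, coeffMap_commute_conjST cX, cY, coeffMap_commute_conjST cY,
      coeffMap_commute_sEuler h, coeffMap_commute_conjST (coeffMap_commute_sEuler h),
      coeffMap_commute_divDiff h, cD h, coeffMap_commute_swapST h⟩
  · refine hX.bracket_eq_zero fun i => smul_coeffMap_bracket (cT _) (cD _) ?_
    rw [conjST_pow]
    exact pow_sMul_bracket _
  · refine hY.bracket_eq_zero fun i => smul_coeffMap_bracket (cT _) (cD _) ?_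
    rw [conjST_pow]
    exact pow_sDiv_bracket _
  · have e₅ := congrArg conjST e₄
    simp only [conjST_sub, conjST_mul, conjST_conjST] at e₅
    rw [← weightedShift_sub_conj, e₄, ← e₅]
    abel

/-- The operator on the model attached to the alphabet of `s`. -/
def sOp (h : Module.End F B) (a b : F) (X Y : Module.End F (ℕ × ℕ →₀ B)) :
    Module.End F (ℕ × ℕ →₀ B) :=
  a • X + Y + b • sEuler F B + coeffMap h * conjST (divDiff F B)

lemma conjST_sOp : conjST (sOp h a b X Y)
    = a • conjST X + conjST Y + b • conjST (sEuler F B) + coeffMap h * divDiff F B := by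
  simp only [sOp, conjST_add, conjST_smul, conjST_mul, conjST_coeffMap, conjST_conjST]

lemma conjST_sOp_mul_sMul
    (hX : HasLocSum (fun i => (i + 1 : F) • (coeffMap (d i) * sMul F B ^ (i + 1))) X)
    (hY : HasLocSum (fun i => (1 : F) • (coeffMap (p i) * sDiv F B ^ (i + 1))) Y) :
    conjST (sOp h a b X Y) * sMul F B
      = sMul F B * (conjST (sOp h a b X Y) + coeffMap h * swapST F B) := by
  have cX : Commute (sMul F B) (conjST X) := hX.conjST.commute fun i => by
    rw [conjST_smul, conjST_mul, conjST_coeffMap, conjST_pow]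
    exact ((coeffMap_commute_sMul _).symm.mul_right
      (sMul_commute_conj_sMul.pow_right _)).smul_right _
  have cY : Commute (sMul F B) (conjST Y) := hY.conjST.commute fun i => by
    rw [conjST_smul, conjST_mul, conjST_coeffMap, conjST_pow]
    exact ((coeffMap_commute_sMul _).symm.mul_right
      (sMul_commute_conj_sDiv.pow_right _)).smul_right _
  rw [conjST_sOp]
  simp only [add_mul, mul_add, smul_mul_assoc, mul_smul_comm, cX.eq, cY.eq,
    sMul_commute_conj_sEuler.eq]
  rw [mul_assoc, divDiff_mul_sMul, mul_add]
  simp only [← mul_assoc, (coeffMap_commute_sMul h).eq]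
  abel

theorem sOp_commutator
    (hX : HasLocSum (fun i => (i + 1 : F) • (coeffMap (d i) * sMul F B ^ (i + 1))) X)
    (hY : HasLocSum (fun i => (1 : F) • (coeffMap (p i) * sDiv F B ^ (i + 1))) Y)
    (hdp : ∀ i j, d i * p j - p j * d i = if j = i then 1 else 0)
    (hdd : ∀ i j, Commute (d i) (d j)) (hpp : ∀ i j, Commute (p i) (p j))
    (hhd : ∀ i, Commute h (d i)) (hhp : ∀ i, Commute h (p i))
    (hh : h * h = b • h + algebraMap F _ a) (l : List F)
    {L₁ L₂ t Δ : Module.End F (ℕ × ℕ →₀ B)} (hL₁ : L₁ = sOp h a b X Y) (hL₂ : L₂ = conjST L₁)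
    (ht : t = conjST (sMul F B)) (hΔ : Δ = coeffMap h * swapST F B) :
    t * (shiftProd l L₂ * (L₂ * (sMul F B * shiftProd l L₁)))
      - sMul F B * (shiftProd l L₁ * (t * (shiftProd l L₂ * L₂)))
      = sMul F B * (shiftProd l L₁ * (t * (Δ * shiftProd l L₁))) := by
  have k₂ := conjST_sOp_mul_sMul (h := h) (a := a) (b := b) hX hY
  have k₁ := congrArg conjST k₂
  have cc : ∀ {φ ψ : Module.End F B}, Commute φ ψ → Commute (coeffMap φ) (coeffMap ψ) := by
    intro φ ψ hc
    rw [commute_iff_eq, ← coeffMap_mul, hc.eq, coeffMap_mul]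
  have cX : Commute (coeffMap h) X := hX.commute fun i =>
    ((cc (hhd i)).mul_right ((coeffMap_commute_sMul h).pow_right _)).smul_right _
  have cY : Commute (coeffMap h) Y := hY.commute fun i =>
    ((cc (hhp i)).mul_right ((coeffMap_commute_sDiv h).pow_right _)).smul_right _
  have cL : Commute (coeffMap h) (sOp h a b X Y) :=
    (((cX.smul_right a).add_right cY).add_right ((coeffMap_commute_sEuler h).smul_right b)).add_right
      ((Commute.refl _).mul_right (coeffMap_commute_conjST (coeffMap_commute_divDiff h)))
  have c₁ := laplaceBeltrami_commute hX hY hdp hdd hpp hhd hhp hh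
  rw [← conjST_sOp, ← sOp] at c₁
  have c₂ := Commute.conjST c₁
  simp only [conjST_mul, conjST_add, conjST_conjST, conjST_coeffMap, conjST_swapST] at k₁ c₂
  subst hL₁ hL₂ ht hΔ
  refine commutator_shiftProd sMul_commute_conj_sMul k₁ k₂ ?_ ?_ c₁ c₂.symm l
  · rw [mul_assoc, swapST_mul_eq, ← mul_assoc, (coeffMap_commute_conjST cL).eq, mul_assoc]
  · rw [mul_assoc, swapST_mul_eq, conjST_conjST, ← mul_assoc, cL.eq, mul_assoc]

end operators
end model

section finiteness

lemma isLinearMap_finsum {φ : ℕ → R → R} (h : ∀ i, IsLinearMap K (φ i))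
    (hf : ∀ f, ∃ N, ∀ i ≥ N, φ i f = 0) : IsLinearMap K fun f => ∑ᶠ i, φ i f := by
  have fin : ∀ f, (Function.support fun i => φ i f).Finite := fun f => by
    obtain ⟨N, hN⟩ := hf f
    refine (Set.finite_lt_nat N).subset fun i hi => ?_
    by_contra hc
    exact hi (hN i (not_lt.1 hc))
  refine ⟨fun f g => ?_, fun c f => ?_⟩
  · rw [← finsum_add_distrib (fin f) (fin g)]
    exact finsum_congr fun i => (h i).map_add f g
  · rw [smul_finsum' c (fin f)]
    exact finsum_congr fun i => (h i).map_smul c f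

lemma isLinearMap_finsum₂ {φ : ℕ → ℕ → R → R} (h : ∀ i j, IsLinearMap K (φ i j))
    (h₁ : ∀ f, ∃ N, ∀ i ≥ N, ∀ j, φ i j f = 0) (h₂ : ∀ f, ∃ N, ∀ j ≥ N, ∀ i, φ i j f = 0) :
    IsLinearMap K fun f => ∑ᶠ (i) (j), φ i j f := by
  refine isLinearMap_finsum (fun i => isLinearMap_finsum (h i) fun f => ?_) fun f => ?_
  · obtain ⟨N, hN⟩ := h₂ f
    exact ⟨N, fun j hj => hN j hj i⟩
  · obtain ⟨N, hN⟩ := h₁ f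
    exact ⟨N, fun i hi => by simp [hN i hi]⟩

lemma isLinearMap_finsum₃ {φ : ℕ → ℕ → ℕ → R → R} (h : ∀ i j k, IsLinearMap K (φ i j k))
    (h₁ : ∀ f, ∃ N, ∀ i ≥ N, ∀ j k, φ i j k f = 0) (h₂ : ∀ f, ∃ N, ∀ j ≥ N, ∀ i k, φ i j k f = 0)
    (h₃ : ∀ f, ∃ N, ∀ k ≥ N, ∀ i j, φ i j k f = 0) :
    IsLinearMap K fun f => ∑ᶠ (i) (j) (k), φ i j k f := by
  refine isLinearMap_finsum (fun i => isLinearMap_finsum₂ (h i) (fun f => ?_) fun f => ?_)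
    fun f => ?_
  · obtain ⟨N, hN⟩ := h₂ f
    exact ⟨N, fun j hj k => hN j hj i k⟩
  · obtain ⟨N, hN⟩ := h₃ f
    exact ⟨N, fun k hk j => hN k hk i j⟩
  · obtain ⟨N, hN⟩ := h₁ f
    exact ⟨N, fun i hi => by simp [hN i hi]⟩

lemma exists_pderiv_eq_zero {σ : Type*} {a : ℕ → σ} (ha : a.Injective) (f : MvPolynomial σ K) :
    ∃ N, ∀ i ≥ N, pderiv (a i) f = 0 := by
  classical
  obtain ⟨N, hN⟩ := ((f.vars.finite_toSet.preimage ha.injOn).bddAbove)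
  refine ⟨N + 1, fun i hi => pderiv_eq_zero_of_notMem_vars fun hc => ?_⟩
  have := hN (show i ∈ a ⁻¹' _ from hc)
  omega

lemma pderiv_pderiv_comm {σ : Type*} (i j : σ) (f : MvPolynomial σ K) :
    pderiv i (pderiv j f) = pderiv j (pderiv i f) := by
  classical
  have : ⁅pderiv (R := K) i, pderiv (R := K) j⁆ = 0 := by
    refine MvPolynomial.derivation_ext fun k => ?_
    rw [Derivation.commutator_apply, pderiv_X, pderiv_X, Pi.single_apply, Pi.single_apply]
    split_ifs <;> simp
  have := congrArg (fun D => D f) this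
  rw [Derivation.commutator_apply] at this
  exact sub_eq_zero.1 this

lemma isLinearMap_mul_pderiv (g : R) (v : Var) : IsLinearMap K fun f => g * pderiv v f :=
  ((LinearMap.mulLeft K g) ∘ₗ (pderiv v).toLinearMap).isLinear

lemma isLinearMap_mul_pderiv_pderiv (g : R) (v w : Var) :
    IsLinearMap K fun f => g * pderiv v (pderiv w f) :=
  ((LinearMap.mulLeft K g) ∘ₗ (pderiv v).toLinearMap ∘ₗ (pderiv w).toLinearMap).isLinear

lemma IsLinearMap.const_smul {φ : R → R} (h : IsLinearMap K φ) (c : K) :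
    IsLinearMap K fun f => c • φ f := (c • h.mk' φ).isLinear

lemma IsLinearMap.add_fun {φ ψ : R → R} (h : IsLinearMap K φ) (h' : IsLinearMap K ψ) :
    IsLinearMap K fun f => φ f + ψ f := (h.mk' φ + h'.mk' ψ).isLinear

lemma isLinearMap_Plus {a : ℕ → Var} (ha : a.Injective) : IsLinearMap K (Plus a) :=
  isLinearMap_finsum (fun _ => isLinearMap_mul_pderiv _ _) fun f => by
    obtain ⟨N, hN⟩ := exists_pderiv_eq_zero ha f
    exact ⟨N, fun i hi => by rw [hN i hi, mul_zero]⟩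

lemma p_injective : Function.Injective Var.p := fun _ _ h => by injection h
lemma y_injective : Function.Injective Var.y := fun _ _ h => by injection h
lemma y'_injective : Function.Injective Var.y' := fun _ _ h => by injection h
lemma z_injective : Function.Injective Var.z := fun _ _ h => by injection h
lemma z'_injective : Function.Injective Var.z' := fun _ _ h => by injection h

lemma isLinearMap_Lam {a : ℕ → Var} (ha : a.Injective) : IsLinearMap K (Lam a) := by
  have va := exists_pderiv_eq_zero ha
  have vp := exists_pderiv_eq_zero p_injective
  refine IsLinearMap.add_fun (IsLinearMap.add_fun (IsLinearMap.const_smul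
    (isLinearMap_finsum₂ (fun i j => (isLinearMap_mul_pderiv_pderiv _ _ _).const_smul _)
      (fun f => ?_) fun f => ?_) _)
    (isLinearMap_finsum₂ (fun i j => isLinearMap_mul_pderiv _ _) (fun f => ?_) fun f => ?_))
    (IsLinearMap.const_smul (isLinearMap_finsum
      (fun i => (isLinearMap_mul_pderiv _ _).const_smul _) fun f => ?_) _)
  · obtain ⟨N, hN⟩ := vp f
    exact ⟨N, fun i hi j => by rw [pderiv_pderiv_comm, hN (i + 1) (by omega)]; simp⟩
  · obtain ⟨N, hN⟩ := va f
    exact ⟨N, fun j hj i => by rw [hN j hj]; simp⟩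
  · obtain ⟨N, hN⟩ := va f
    exact ⟨N, fun i hi j => by rw [hN (i + j + 1) (by omega)]; simp⟩
  · obtain ⟨N, hN⟩ := va f
    exact ⟨N, fun j hj i => by rw [hN (i + j + 1) (by omega)]; simp⟩
  · obtain ⟨N, hN⟩ := va f
    exact ⟨N, fun i hi => by rw [hN (i + 1) (by omega)]; simp⟩

lemma isLinearMap_transfer {a c : ℕ → Var} (ha : a.Injective) (hc : c.Injective)
    (x w : ℕ → R) : IsLinearMap K fun f : R => ∑ᶠ (i : ℕ) (j : ℕ) (k : ℕ), x (i + j + 1) * w k *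
      pderiv (c (i + k + 1)) (pderiv (a j) f) := by
  refine isLinearMap_finsum₃ (fun i j k => isLinearMap_mul_pderiv_pderiv _ _ _)
    (fun f => ?_) (fun f => ?_) fun f => ?_
  · obtain ⟨N, hN⟩ := exists_pderiv_eq_zero hc f
    exact ⟨N, fun i hi j k => by rw [pderiv_pderiv_comm, hN _ (by omega)]; simp⟩
  · obtain ⟨N, hN⟩ := exists_pderiv_eq_zero ha f
    exact ⟨N, fun j hj i k => by rw [hN j hj]; simp⟩
  · obtain ⟨N, hN⟩ := exists_pderiv_eq_zero hc f
    exact ⟨N, fun k hk i j => by rw [pderiv_pderiv_comm, hN _ (by omega)]; simp⟩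

lemma isLinearMap_MZ : IsLinearMap K MZ :=
  (((isLinearMap_transfer z_injective y_injective (fun i => X (Var.y' i))
    fun k => X (Var.z' k)).const_smul alpha).add_fun
    (isLinearMap_transfer z'_injective y'_injective (fun i => X (Var.y i))
      fun k => X (Var.z k))).add_fun
    ((isLinearMap_transfer z'_injective y'_injective (fun i => X (Var.y' i))
      fun k => X (Var.z' k)).const_smul bb)

lemma isLinearMap_LamZt : IsLinearMap K LamZt :=
  ((isLinearMap_Lam z_injective).add_fun (isLinearMap_Lam z'_injective)).add_fun isLinearMap_MZ

lemma isLinearMap_Ztplus : IsLinearMap K Ztplus :=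
  (isLinearMap_Plus z_injective).add_fun (isLinearMap_Plus z'_injective)

lemma isLinearMap_ThZt : IsLinearMap K ThZt := by
  refine IsLinearMap.add_fun (IsLinearMap.add_fun (pderiv (Var.z 0)).toLinearMap.isLinear
    (isLinearMap_finsum (fun i => isLinearMap_mul_pderiv _ _) fun f => ?_))
    (isLinearMap_finsum₂ (fun i j => isLinearMap_mul_pderiv_pderiv _ _ _)
      (fun f => ?_) fun f => ?_)
  · obtain ⟨N, hN⟩ := exists_pderiv_eq_zero z_injective f
    exact ⟨N, fun i hi => by rw [hN (i + 1) (by omega)]; simp⟩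
  · obtain ⟨N, hN⟩ := exists_pderiv_eq_zero y'_injective f
    exact ⟨N, fun i hi j => by rw [pderiv_pderiv_comm, hN i hi]; simp⟩
  · obtain ⟨N, hN⟩ := exists_pderiv_eq_zero z'_injective f
    exact ⟨N, fun j hj i => by rw [hN j hj]; simp⟩

end finiteness

section evaluation

lemma pderiv_letter {a : ℕ → Var} (ha : a.Injective) {g : R} (hg : ∀ j, pderiv (a j) g = 0)
    (j m : ℕ) : pderiv (a j) (X (a m) * g) = if j = m then g else 0 := by
  classical
  rw [Derivation.leibniz, hg, pderiv_X, Pi.single_apply]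
  simp only [ha.eq_iff, eq_comm (a := m)]
  split_ifs <;> simp

lemma Lam_eq_zero {a : ℕ → Var} {f : R} (hf : ∀ j, pderiv (a j) f = 0) : Lam a f = 0 := by
  simp [Lam, hf]

lemma Plus_eq_zero {a : ℕ → Var} {f : R} (hf : ∀ j, pderiv (a j) f = 0) : Plus a f = 0 := by
  simp [Plus, hf]

lemma Plus_letter {a : ℕ → Var} (ha : a.Injective) {g : R} (hg : ∀ j, pderiv (a j) g = 0)
    (m : ℕ) : Plus a (X (a m) * g) = X (a (m + 1)) * g := by
  rw [Plus, finsum_eq_single _ m fun i hi => by rw [pderiv_letter ha hg, if_neg hi, mul_zero],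
    pderiv_letter ha hg, if_pos rfl]

lemma finsum_eq_sum_range {φ : ℕ → R} {N : ℕ} (h : ∀ i ≥ N, φ i = 0) :
    ∑ᶠ i, φ i = ∑ i ∈ Finset.range N, φ i :=
  finsum_eq_sum_of_support_subset _ fun i hi => by
    by_contra hc
    exact hi (h i (by simpa using hc))

/-- The antidiagonal sum `∑_{i + j + 1 = m}` as a sum over `i`. -/
lemma finsum_antidiagonal {φ : ℕ → ℕ → R → R} (h₀ : ∀ i j, φ i j 0 = 0) (g : R) (m : ℕ) :
    ∑ᶠ (i : ℕ) (j : ℕ), φ i j (if i + j + 1 = m then g else 0)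
      = ∑ i ∈ Finset.range m, φ i (m - 1 - i) g := by
  rw [finsum_eq_sum_range (N := m)]
  · refine Finset.sum_congr rfl fun i hi => ?_
    have := Finset.mem_range.1 hi
    rw [finsum_eq_single _ (m - 1 - i), if_pos (by omega)]
    intro j hj
    rw [if_neg (by omega), h₀]
  · intro i hi
    refine finsum_eq_zero_of_forall_eq_zero fun j => ?_
    rw [if_neg (by omega), h₀]

lemma Lam_letter {a : ℕ → Var} (ha : a.Injective) {g : R} (hg : ∀ j, pderiv (a j) g = 0)
    (m : ℕ) {N : ℕ} (hN : ∀ i ≥ N, pderiv (Var.p (i + 1)) g = 0) :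
    Lam a (X (a m) * g)
      = alpha • ∑ i ∈ Finset.range N,
          (i + 1 : K) • (X (a (m + i + 1)) * pderiv (Var.p (i + 1)) g)
        + ∑ j ∈ Finset.range m, X (a (m - 1 - j)) * (X (Var.p (j + 1)) * g)
        + bb • (m : K) • (X (a m) * g) := by
  simp only [Lam, pderiv_letter ha hg]
  congr 1
  · congr 1
    · congr 1
      rw [finsum_eq_sum_range (N := N)]
      · refine Finset.sum_congr rfl fun i _ => ?_
        rw [finsum_eq_single _ m fun j hj => by rw [if_neg hj]; simp, if_pos rfl, add_comm m i,
          Nat.cast_succ]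
      · intro i hi
        refine finsum_eq_zero_of_forall_eq_zero fun j => ?_
        split_ifs <;> simp [hN i hi]
    · rw [finsum_antidiagonal (φ := fun i j x => X (a i) * X (Var.p (j + 1)) * x) (by simp),
        ← Finset.sum_range_reflect]
      refine Finset.sum_congr rfl fun j hj => ?_
      have := Finset.mem_range.1 hj
      rw [mul_assoc, show m - 1 - (m - 1 - j) = j by omega]
  · congr 1
    cases m with
    | zero => simp
    | succ m =>
      rw [finsum_eq_single _ m fun j hj => by rw [if_neg (by omega)]; simp, if_pos rfl]

lemma transfer_eq (x w : ℕ → Var) (g : R) (m n : ℕ) :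
    ∑ᶠ (i : ℕ) (j : ℕ) (k : ℕ), X (x (i + j + 1)) * X (w k) *
        (if i + k + 1 = n ∧ j = m then g else 0)
      = ∑ i ∈ Finset.range n, X (w (n - 1 - i)) * (X (x (m + i + 1)) * g) := by
  have e : ∀ i : ℕ, ∑ᶠ (j : ℕ) (k : ℕ),
      X (x (i + j + 1)) * X (w k) * (if i + k + 1 = n ∧ j = m then g else 0)
      = ∑ᶠ (k : ℕ), X (x (i + m + 1)) * X (w k) * (if i + k + 1 = n then g else 0) := by
    intro i
    rw [finsum_eq_single _ m fun j hj => finsum_eq_zero_of_forall_eq_zero fun k => by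
      rw [if_neg (by tauto)]; simp]
    simp
  rw [finsum_congr e,
    finsum_antidiagonal (φ := fun i k y => X (x (i + m + 1)) * X (w k) * y) (by simp)]
  refine Finset.sum_congr rfl fun i _ => ?_
  rw [add_comm m i]; ring

end evaluation

section embedding
open Finsupp

/-- The polynomials in the variables `p_i`. -/
abbrev A : Type := MvPolynomial ℕ K

/-- The inclusion of the polynomials in the `p`-variables. -/
def inclP : A →ₐ[K] R := rename Var.p

/-- The coefficient derivative `∂/∂p_{i+1}`. -/
def coeffD (i : ℕ) : Module.End K (A × A) :=
  LinearMap.prodMap (pderiv (i + 1)).toLinearMap (pderiv (i + 1)).toLinearMap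

/-- The coefficient multiplication by `p_{i+1}`. -/
def coeffP (i : ℕ) : Module.End K (A × A) :=
  LinearMap.prodMap (LinearMap.mulLeft K (X (i + 1))) (LinearMap.mulLeft K (X (i + 1)))

/-- Multiplication by the generator `h` of `A[h] / (h² - b h - α)`. -/
def coeffH : Module.End K (A × A) :=
  LinearMap.prod (LinearMap.snd K A A) (alpha • LinearMap.fst K A A + bb • LinearMap.snd K A A)

@[simp] lemma coeffD_apply (i : ℕ) (q q' : A) :
    coeffD i (q, q') = (pderiv (i + 1) q, pderiv (i + 1) q') := rfl

@[simp] lemma coeffP_apply (i : ℕ) (q q' : A) :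
    coeffP i (q, q') = (X (i + 1) * q, X (i + 1) * q') := rfl

@[simp] lemma coeffH_apply (q q' : A) : coeffH (q, q') = (q', alpha • q + bb • q') := rfl

lemma coeffD_coeffP (i j : ℕ) :
    coeffD i * coeffP j - coeffP j * coeffD i = if j = i then 1 else 0 := by
  refine LinearMap.ext fun ⟨q, q'⟩ => ?_
  simp only [LinearMap.sub_apply, Module.End.mul_apply, coeffD_apply, coeffP_apply,
    Derivation.leibniz, pderiv_X, Pi.single_apply, Prod.mk_sub_mk, smul_eq_mul]
  split_ifs with h₁ h₂ h₂ <;> first | omega | simp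

lemma coeffD_commute (i j : ℕ) : Commute (coeffD i) (coeffD j) :=
  LinearMap.ext fun _ => Prod.ext (pderiv_pderiv_comm _ _ _) (pderiv_pderiv_comm _ _ _)

lemma coeffP_commute (i j : ℕ) : Commute (coeffP i) (coeffP j) :=
  LinearMap.ext fun _ => Prod.ext (mul_left_comm _ _ _) (mul_left_comm _ _ _)

lemma coeffH_commute_coeffD (i : ℕ) : Commute coeffH (coeffD i) :=
  LinearMap.ext fun ⟨q, q'⟩ => by simp

lemma coeffH_commute_coeffP (i : ℕ) : Commute coeffH (coeffP i) :=
  LinearMap.ext fun ⟨q, q'⟩ => by simp [mul_add]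

lemma coeffH_mul_self : coeffH * coeffH = bb • coeffH + algebraMap K _ alpha :=
  LinearMap.ext fun ⟨q, q'⟩ => by
    simp [Module.algebraMap_end_apply, add_comm]

lemma eventually_coeffD_eq_zero (b : A × A) : ∀ᶠ i in Filter.atTop, coeffD i b = 0 := by
  obtain ⟨q, q'⟩ := b
  obtain ⟨N, hN⟩ := exists_pderiv_eq_zero Function.injective_id q
  obtain ⟨N', hN'⟩ := exists_pderiv_eq_zero Function.injective_id q'
  filter_upwards [Filter.eventually_ge_atTop (max N N')] with i hi
  simp only [id, ge_iff_le, max_le_iff] at *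
  rw [coeffD_apply, hN _ (by omega), hN' _ (by omega)]; rfl

lemma eventually_finsupp_eq_zero {B M' : Type*} [AddCommGroup B] [Module K B] [AddCommGroup M']
    [Module K M'] {φ : ℕ → (ℕ × ℕ →₀ B) →ₗ[K] M'}
    (h : ∀ m n b, ∀ᶠ i in Filter.atTop, φ i (single (m, n) b) = 0) (v : ℕ × ℕ →₀ B) :
    ∀ᶠ i in Filter.atTop, φ i v = 0 := by
  induction v using Finsupp.induction_linear with
  | zero => simp
  | add f g hf hg =>
    filter_upwards [hf, hg] with i a b
    rw [map_add, a, b, add_zero]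
  | single x b => exact h x.1 x.2 b

lemma exists_creation : ∃ T : Module.End K (ℕ × ℕ →₀ A × A),
    HasLocSum (fun i => (i + 1 : K) • (coeffMap (coeffD i) * sMul K (A × A) ^ (i + 1))) T :=
  HasLocSum.exists_of_eventually <| eventually_finsupp_eq_zero fun m n b => by
    filter_upwards [eventually_coeffD_eq_zero b] with i hi
    simp [sMul_pow_single, hi]

lemma exists_annihilation : ∃ T : Module.End K (ℕ × ℕ →₀ A × A),
    HasLocSum (fun i => (1 : K) • (coeffMap (coeffP i) * sDiv K (A × A) ^ (i + 1))) T :=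
  HasLocSum.exists_of_eventually <| eventually_finsupp_eq_zero fun m n b => by
    filter_upwards [Filter.eventually_ge_atTop m] with i hi
    rw [LinearMap.smul_apply, Module.End.mul_apply, sDiv_pow_single, if_neg (by omega)]
    simp

/-- The operator `∑ i ∂/∂p_i s ^ i`. -/
def creation : Module.End K (ℕ × ℕ →₀ A × A) := exists_creation.choose

/-- The operator `∑ p_j s ^ (-j)`. -/
def annihilation : Module.End K (ℕ × ℕ →₀ A × A) := exists_annihilation.choose

lemma creation_single {m n N : ℕ} {b : A × A} (hN : ∀ i ≥ N, coeffD i b = 0) :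
    creation (single (m, n) b)
      = ∑ i ∈ Finset.range N, (i + 1 : K) • single (m + i + 1, n) (coeffD i b) := by
  obtain ⟨N', h, hN'⟩ := ((exists_creation.choose_spec (single (m, n) b)).and
    (Filter.eventually_ge_atTop N)).exists
  rw [creation, ← h]
  symm
  refine (Finset.sum_congr rfl fun i _ => ?_).trans
    (Finset.sum_subset (Finset.range_subset_range.2 hN') fun i _ hi => ?_)
  · simp [sMul_pow_single, add_assoc]
  · simp [sMul_pow_single, hN i (by simpa using hi)]

lemma annihilation_single {m n : ℕ} {b : A × A} :
    annihilation (single (m, n) b)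
      = ∑ j ∈ Finset.range m, single (m - 1 - j, n) (coeffP j b) := by
  obtain ⟨N', h, hN'⟩ := ((exists_annihilation.choose_spec (single (m, n) b)).and
    (Filter.eventually_ge_atTop m)).exists
  rw [annihilation, ← h]
  symm
  refine (Finset.sum_congr rfl fun i hi => ?_).trans
    (Finset.sum_subset (Finset.range_subset_range.2 hN') fun i _ hi => ?_)
  · have := Finset.mem_range.1 hi
    simp only [one_smul, Module.End.mul_apply]
    rw [sDiv_pow_single, if_pos (by omega), coeffMap_single,
      show m - 1 - i = m - (i + 1) by omega]
  · rw [Finset.mem_range] at hi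
    simp only [one_smul, Module.End.mul_apply]
    rw [sDiv_pow_single, if_neg (by omega), map_zero]

/-- The Laplace-Beltrami operator `Λ_Ỹ` on the model. -/
def modelL : Module.End K (ℕ × ℕ →₀ A × A) := sOp coeffH alpha bb creation annihilation

lemma modelL_single {m n N : ℕ} {b : A × A} (hN : ∀ i ≥ N, coeffD i b = 0) :
    modelL (single (m, n) b)
      = alpha • ∑ i ∈ Finset.range N, (i + 1 : K) • single (m + i + 1, n) (coeffD i b)
        + ∑ j ∈ Finset.range m, single (m - 1 - j, n) (coeffP j b)
        + bb • (m : K) • single (m, n) b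
        + ∑ i ∈ Finset.range n, single (n - 1 - i, m + i + 1) (coeffH b) := by
  simp only [modelL, sOp, LinearMap.add_apply, LinearMap.smul_apply, Module.End.mul_apply,
    creation_single hN, annihilation_single, sEuler_single, conjST_single, divDiff_single, map_sum,
    swapST_single, coeffMap_single]

/-- The space spanned by `y_m z_n p_λ + …`: the coefficient `(q, q')` of `(m, n)` stands for
`y_m z_n q + y'_m z'_n q'`. -/
def emb : (ℕ × ℕ →₀ A × A) →ₗ[K] R :=
  lsum K fun x =>
    LinearMap.mulLeft K (X (Var.y x.1)) ∘ₗ LinearMap.mulLeft K (X (Var.z x.2))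
        ∘ₗ inclP.toLinearMap ∘ₗ LinearMap.fst K A A
      + LinearMap.mulLeft K (X (Var.y' x.1)) ∘ₗ LinearMap.mulLeft K (X (Var.z' x.2))
        ∘ₗ inclP.toLinearMap ∘ₗ LinearMap.snd K A A

@[simp] lemma emb_single (m n : ℕ) (q q' : A) : emb (single (m, n) (q, q'))
    = X (Var.y m) * (X (Var.z n) * inclP q) + X (Var.y' m) * (X (Var.z' n) * inclP q') := by
  simp [emb]

@[simp] lemma pderiv_p_inclP (i : ℕ) (q : A) :
    pderiv (Var.p i) (inclP q) = inclP (pderiv i q) :=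
  pderiv_rename p_injective i q

lemma pderiv_inclP {v : Var} (hv : ∀ i, v ≠ Var.p i) (q : A) : pderiv v (inclP q) = 0 := by
  classical
  refine pderiv_eq_zero_of_notMem_vars fun h => ?_
  obtain ⟨i, -, hi⟩ := Finset.mem_image.1 (vars_rename Var.p q h)
  exact hv i hi.symm

@[simp] lemma pderiv_y_inclP (i : ℕ) (q : A) : pderiv (Var.y i) (inclP q) = 0 :=
  pderiv_inclP (by simp) q
@[simp] lemma pderiv_y'_inclP (i : ℕ) (q : A) : pderiv (Var.y' i) (inclP q) = 0 :=
  pderiv_inclP (by simp) q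
@[simp] lemma pderiv_z_inclP (i : ℕ) (q : A) : pderiv (Var.z i) (inclP q) = 0 :=
  pderiv_inclP (by simp) q
@[simp] lemma pderiv_z'_inclP (i : ℕ) (q : A) : pderiv (Var.z' i) (inclP q) = 0 :=
  pderiv_inclP (by simp) q

@[simp] lemma inclP_X (i : ℕ) : inclP (X i) = X (Var.p i) := rename_X _ _

lemma exists_bound (q : A) : ∃ N, ∀ i ≥ N, pderiv (i + 1) q = 0 := by
  obtain ⟨N, hN⟩ := exists_pderiv_eq_zero Function.injective_id q
  exact ⟨N, fun i hi => hN _ (by omega)⟩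

section intertwining
open Finsupp

lemma LamZt_y_z (m n : ℕ) (q : A) :
    LamZt (X (Var.y m) * (X (Var.z n) * inclP q))
      = emb (conjST modelL (single (m, n) (q, 0))) := by
  obtain ⟨N, hN⟩ := exists_bound q
  rw [conjST_single, modelL_single (N := N) fun i hi => by simp [hN i hi], LamZt,
    Lam_eq_zero (a := Var.z') fun j => by simp [pderiv_X], mul_left_comm,
    Lam_letter z_injective (N := N) (by simp [pderiv_X]) n fun i hi => by simp [pderiv_X, hN i hi],
    MZ]
  have e₁ : ∀ r j, pderiv (Var.y r) (pderiv (Var.z j) (X (Var.z n) * (X (Var.y m) * inclP q)))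
      = if r = m ∧ j = n then inclP q else 0 := by
    intro r j
    rw [pderiv_letter z_injective (by simp [pderiv_X])]
    split_ifs with h₁ h₂ h₂ <;> simp_all [pderiv_letter y_injective]
  have e₂ : ∀ j, pderiv (Var.z' j) (X (Var.z n) * (X (Var.y m) * inclP q)) = 0 := by
    simp [pderiv_X]
  simp only [e₁, e₂, transfer_eq, map_zero, mul_zero, finsum_zero, smul_zero, add_zero]
  simp only [map_add, map_smul, map_sum, coeffD_apply, coeffP_apply, coeffH_apply, emb_single,
    map_zero, mul_zero, add_zero, zero_add, smul_zero, map_mul, swapST_single]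
  simp [pderiv_X, Finset.smul_sum, mul_left_comm]

lemma LamZt_y'_z' (m n : ℕ) (q : A) :
    LamZt (X (Var.y' m) * (X (Var.z' n) * inclP q))
      = emb (conjST modelL (single (m, n) (0, q))) := by
  obtain ⟨N, hN⟩ := exists_bound q
  rw [conjST_single, modelL_single (N := N) fun i hi => by simp [hN i hi], LamZt,
    Lam_eq_zero (a := Var.z) fun j => by simp [pderiv_X], mul_left_comm,
    Lam_letter z'_injective (N := N) (by simp [pderiv_X]) n fun i hi => by simp [pderiv_X, hN i hi],
    MZ]
  have e₁ : ∀ r j, pderiv (Var.y' r) (pderiv (Var.z' j) (X (Var.z' n) * (X (Var.y' m) * inclP q)))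
      = if r = m ∧ j = n then inclP q else 0 := by
    intro r j
    rw [pderiv_letter z'_injective (by simp [pderiv_X])]
    split_ifs with h₁ h₂ h₂ <;> simp_all [pderiv_letter y'_injective]
  have e₂ : ∀ j, pderiv (Var.z j) (X (Var.z' n) * (X (Var.y' m) * inclP q)) = 0 := by
    simp [pderiv_X]
  simp only [e₁, e₂, transfer_eq, map_zero, mul_zero, finsum_zero, smul_zero, zero_add]
  simp only [map_add, map_smul, map_sum, coeffD_apply, coeffP_apply, coeffH_apply, emb_single,
    map_zero, mul_zero, zero_add, smul_zero, map_mul, swapST_single]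
  simp [pderiv_X, Finset.smul_sum, mul_left_comm, Finset.sum_add_distrib, add_assoc]

/-- Two linear operators on the model agree if they agree on the coefficients `(q, 0)` and
`(0, q)`. -/
lemma model_prod_ext {M' : Type*} [AddCommGroup M'] [Module K M']
    {T U : (ℕ × ℕ →₀ A × A) →ₗ[K] M'}
    (h : ∀ m n q, T (single (m, n) (q, 0)) = U (single (m, n) (q, 0)))
    (h' : ∀ m n q, T (single (m, n) (0, q)) = U (single (m, n) (0, q))) : T = U := by
  refine lhom_ext fun x b => ?_
  obtain ⟨m, n⟩ := x
  obtain ⟨q, q'⟩ := b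
  have : single (m, n) (q, q') = single (m, n) (q, 0) + single (m, n) (0, q') := by
    rw [← single_add]; simp
  rw [this, map_add, map_add, h, h']

lemma LamZt_emb (v : ℕ × ℕ →₀ A × A) : LamZt (emb v) = emb (conjST modelL v) := by
  have : isLinearMap_LamZt.mk' LamZt ∘ₗ emb = emb ∘ₗ conjST modelL :=
    model_prod_ext (fun m n q => by simpa using LamZt_y_z m n q)
      fun m n q => by simpa using LamZt_y'_z' m n q
  exact LinearMap.congr_fun this v

lemma Ztplus_emb (v : ℕ × ℕ →₀ A × A) : Ztplus (emb v) = emb (conjST (sMul K (A × A)) v) := by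
  have : isLinearMap_Ztplus.mk' Ztplus ∘ₗ emb = emb ∘ₗ conjST (sMul K (A × A)) := by
    refine model_prod_ext (fun m n q => ?_) fun m n q => ?_
    · simp only [LinearMap.comp_apply, IsLinearMap.mk'_apply, emb_single, conjST_single,
        sMul_single, swapST_single, map_zero, mul_zero, add_zero, Ztplus]
      rw [Plus_eq_zero (a := Var.z') fun j => by simp [pderiv_X], mul_left_comm,
        Plus_letter z_injective (by simp [pderiv_X]), mul_left_comm, add_zero]
    · simp only [LinearMap.comp_apply, IsLinearMap.mk'_apply, emb_single, conjST_single,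
        sMul_single, swapST_single, map_zero, mul_zero, zero_add, Ztplus]
      rw [Plus_eq_zero (a := Var.z) fun j => by simp [pderiv_X], mul_left_comm,
        Plus_letter z'_injective (by simp [pderiv_X]), mul_left_comm, zero_add]
  exact LinearMap.congr_fun this v

/-- The composite of `emb` and `Θ_Z̃`. -/
def thetaEmb : (ℕ × ℕ →₀ A × A) →ₗ[K] R := isLinearMap_ThZt.mk' ThZt ∘ₗ emb

/-- The substitution `z_n ↦ p_n`, with `p_0 = 1`. -/
def evalZ (n : ℕ) : A := if n = 0 then 1 else X n

lemma ThZt_z (m : ℕ) {g : R} (hz : ∀ j, pderiv (Var.z j) g = 0)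
    (hz' : ∀ j, pderiv (Var.z' j) g = 0) : ThZt (X (Var.z m) * g) = inclP (evalZ m) * g := by
  have e : ∀ j, pderiv (Var.z' j) (X (Var.z m) * g) = 0 := by simp [pderiv_X, hz']
  simp only [ThZt, e, map_zero, mul_zero, finsum_zero, add_zero, pderiv_letter z_injective hz]
  cases m with
  | zero => simp [evalZ]
  | succ m =>
    rw [finsum_eq_single _ m fun i hi => by rw [if_neg (by omega), mul_zero]]
    simp [evalZ]

lemma thetaEmb_single_left (m n : ℕ) (q : A) :
    thetaEmb (single (m, n) (q, 0)) = X (Var.y m) * inclP (evalZ n * q) := by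
  simp only [thetaEmb, LinearMap.comp_apply, IsLinearMap.mk'_apply, emb_single, map_zero,
    mul_zero, add_zero]
  rw [mul_left_comm, ThZt_z n (by simp [pderiv_X]) (by simp [pderiv_X]), map_mul, mul_left_comm]

lemma thetaEmb_single_right (m n : ℕ) (q : A) :
    thetaEmb (single (m, n) (0, q)) = X (Var.y (m + n)) * inclP q := by
  simp only [thetaEmb, LinearMap.comp_apply, IsLinearMap.mk'_apply, emb_single, map_zero,
    mul_zero, zero_add]
  have e₁ : ∀ r j, pderiv (Var.y' r) (pderiv (Var.z' j) (X (Var.y' m) * (X (Var.z' n) * inclP q)))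
      = if r = m then if j = n then inclP q else 0 else 0 := by
    intro r j
    rw [pderiv_pderiv_comm, pderiv_letter y'_injective (by simp [pderiv_X])]
    split_ifs with h₁ h₂ <;> simp_all [pderiv_letter z'_injective]
  have e₂ : ∀ j, pderiv (Var.z j) (X (Var.y' m) * (X (Var.z' n) * inclP q)) = 0 := by
    simp [pderiv_X]
  simp only [ThZt, e₁, e₂, mul_zero, finsum_zero, zero_add]
  rw [finsum_eq_single _ m fun i hi => by simp [hi], finsum_eq_single _ n fun i hi => by simp [hi]]
  simp

lemma thetaEmb_single (m n : ℕ) (q q' : A) : thetaEmb (single (m, n) (q, q'))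
    = X (Var.y m) * inclP (evalZ n * q) + X (Var.y (m + n)) * inclP q' := by
  rw [← thetaEmb_single_left, ← thetaEmb_single_right, ← map_add, ← single_add]
  simp

lemma Plus_thetaEmb (v : ℕ × ℕ →₀ A × A) :
    Plus Var.y (thetaEmb v) = thetaEmb (sMul K (A × A) v) := by
  have : (isLinearMap_Plus y_injective).mk' (Plus Var.y) ∘ₗ thetaEmb
      = thetaEmb ∘ₗ sMul K (A × A) := by
    refine model_prod_ext (fun m n q => ?_) fun m n q => ?_ <;>
    simp only [LinearMap.comp_apply, IsLinearMap.mk'_apply, sMul_single, thetaEmb_single_left,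
      thetaEmb_single_right] <;>
    rw [Plus_letter y_injective (by simp)]
    rw [add_right_comm]
  exact LinearMap.congr_fun this v

lemma Lam_y_inclP (m : ℕ) (q : A) {N : ℕ} (hN : ∀ i ≥ N, pderiv (i + 1) q = 0) :
    Lam Var.y (X (Var.y m) * inclP q)
      = alpha • ∑ i ∈ Finset.range N,
          (i + 1 : K) • (X (Var.y (m + i + 1)) * inclP (pderiv (i + 1) q))
        + ∑ j ∈ Finset.range m, X (Var.y (m - 1 - j)) * inclP (X (j + 1) * q)
        + bb • (m : K) • (X (Var.y m) * inclP q) := by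
  rw [Lam_letter y_injective (by simp) m (N := N) fun i hi => by simp [hN i hi]]
  simp

lemma pderiv_evalZ (i n : ℕ) : pderiv (i + 1) (evalZ n) = if i + 1 = n then 1 else 0 := by
  rw [evalZ]
  split_ifs with h₁ h₂ h₂
  · omega
  · simp
  · rw [h₂, pderiv_X_self]
  · rw [pderiv_X_of_ne (Ne.symm h₂)]

lemma Lam_thetaEmb_left (m n : ℕ) (q : A) : Lam Var.y (thetaEmb (single (m, n) (q, 0)))
    = thetaEmb (modelL (single (m, n) (q, 0))) := by
  obtain ⟨N, hN⟩ := exists_bound q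
  obtain ⟨N', hN'⟩ := exists_bound (evalZ n * q)
  obtain ⟨L, hLN, hLN', hLn⟩ : ∃ L, N ≤ L ∧ N' ≤ L ∧ n ≤ L :=
    ⟨N + N' + n, by omega, by omega, by omega⟩
  rw [thetaEmb_single_left, Lam_y_inclP m _ (N := L) fun i hi => hN' i (by omega),
    modelL_single (N := L) fun i hi => by simp [hN i (by omega)]]
  simp only [map_add, map_smul, map_sum, coeffD_apply, coeffP_apply, coeffH_apply,
    map_zero, mul_zero, thetaEmb_single, add_zero, smul_zero, zero_add]
  have e : ∀ i ∈ Finset.range n, X (Var.y (n - 1 - i + (m + i + 1))) * alpha • inclP q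
      = alpha • (X (Var.y (m + n)) * inclP q) := fun i hi => by
    have := Finset.mem_range.1 hi
    rw [show n - 1 - i + (m + i + 1) = m + n by omega, mul_smul_comm]
  have d : ∑ i ∈ Finset.range L,
        (i + 1 : K) • (X (Var.y (m + i + 1)) * inclP (pderiv (i + 1) (evalZ n * q)))
      = ∑ i ∈ Finset.range L,
          (i + 1 : K) • (X (Var.y (m + i + 1)) * inclP (evalZ n * pderiv (i + 1) q))
        + (n : K) • (X (Var.y (m + n)) * inclP q) := by
    simp only [Derivation.leibniz, smul_eq_mul, pderiv_evalZ, map_add, mul_add, smul_add,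
      Finset.sum_add_distrib]
    congr 1
    cases n with
    | zero => simp
    | succ n =>
      rw [Finset.sum_eq_single n]
      · simp [add_assoc]
      · intro i _ hi
        rw [if_neg (by omega)]
        simp
      · intro hn
        exact absurd (Finset.mem_range.2 (by omega)) hn
  rw [Finset.sum_congr rfl e, d, Finset.sum_const, Finset.card_range,
    ← Nat.cast_smul_eq_nsmul K]
  simp only [smul_add, mul_left_comm (evalZ n), smul_comm (n : K) alpha]
  abel

lemma Lam_thetaEmb_right (m n : ℕ) (q : A) : Lam Var.y (thetaEmb (single (m, n) (0, q)))
    = thetaEmb (modelL (single (m, n) (0, q))) := by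
  obtain ⟨N, hN⟩ := exists_bound q
  rw [thetaEmb_single_right, Lam_y_inclP (m + n) _ (N := N) hN,
    modelL_single (N := N) fun i hi => by simp [hN i hi]]
  simp only [map_add, map_smul, map_sum, coeffD_apply, coeffP_apply, coeffH_apply,
    map_zero, mul_zero, thetaEmb_single, zero_add, smul_zero, Finset.sum_add_distrib]
  have e₁ : ∀ i ∈ Finset.range n, X (Var.y (n - 1 - i + (m + i + 1))) * bb • inclP q
      = bb • (X (Var.y (m + n)) * inclP q) := fun i hi => by
    have := Finset.mem_range.1 hi
    rw [show n - 1 - i + (m + i + 1) = m + n by omega, mul_smul_comm]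
  have e₂ : ∀ j ∈ Finset.range m, X (Var.y (m - 1 - j + n)) * inclP (X (j + 1) * q)
      = X (Var.y (m + n - 1 - j)) * inclP (X (j + 1) * q) := fun j hj => by
    have := Finset.mem_range.1 hj
    rw [show m - 1 - j + n = m + n - 1 - j by omega]
  have e₃ : ∀ j ∈ Finset.range n, X (Var.y (n - 1 - j)) * inclP (evalZ (m + j + 1) * q)
      = X (Var.y (m + n - 1 - (m + j))) * inclP (X (m + j + 1) * q) := fun j _ => by
    rw [show n - 1 - j = m + n - 1 - (m + j) by omega, evalZ, if_neg (by omega)]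
  have e₄ : ∀ i, m + i + 1 + n = m + n + i + 1 := by omega
  rw [Finset.sum_congr rfl e₁, Finset.sum_congr rfl e₂, Finset.sum_congr rfl e₃, Finset.sum_const,
    Finset.card_range, ← Nat.cast_smul_eq_nsmul K, Finset.sum_range_add]
  simp only [e₄, Nat.cast_add, smul_add, add_smul, smul_comm (n : K) bb]
  abel

lemma Lam_thetaEmb (v : ℕ × ℕ →₀ A × A) :
    Lam Var.y (thetaEmb v) = thetaEmb (modelL v) := by
  have : (isLinearMap_Lam y_injective).mk' (Lam Var.y) ∘ₗ thetaEmb = thetaEmb ∘ₗ modelL :=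
    model_prod_ext Lam_thetaEmb_left Lam_thetaEmb_right
  exact LinearMap.congr_fun this v

end intertwining

section products

lemma foldr_comp_eq_shiftProd {M : Type*} [AddCommGroup M] [Module K M] {k : ℕ} (u : Fin k → K)
    {φ : K → M → M} {L : Module.End K M} (h : ∀ c f, φ c f = L f + c • f) (f : M) :
    (List.ofFn fun i => φ (u i)).foldr (fun g h => g ∘ h) id f = shiftProd (List.ofFn u) L f := by
  have e : (List.ofFn fun i => φ (u i)) = (List.ofFn u).map φ :=
    (List.map_ofFn (f := u) (g := φ)).symm
  rw [e]
  induction List.ofFn u with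
  | nil => simp [shiftProd]
  | cons a l ih =>
    rw [List.map_cons, List.foldr_cons, Function.comp_apply, ih, shiftProd_cons, h,
      Module.End.mul_apply, LinearMap.add_apply, Module.algebraMap_end_apply]

lemma shiftProd_intertwine {M M' : Type*} [AddCommGroup M] [Module K M] [AddCommGroup M']
    [Module K M'] {φ : M →ₗ[K] M'} {L : Module.End K M} {L' : Module.End K M'}
    (h : ∀ v, L' (φ v) = φ (L v)) (l : List K) (v : M) :
    shiftProd l L' (φ v) = φ (shiftProd l L v) := by
  induction l with
  | nil => simp [shiftProd]
  | cons a l ih =>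
    simp only [shiftProd_cons, Module.End.mul_apply, ih, LinearMap.add_apply, h,
      Module.algebraMap_end_apply, map_add, map_smul]

lemma shiftProd_mem {M : Type*} [AddCommGroup M] [Module K M] {V : Submodule K M}
    {L : Module.End K M} (h : ∀ v ∈ V, L v ∈ V) (l : List K) {v : M} (hv : v ∈ V) :
    shiftProd l L v ∈ V := by
  induction l with
  | nil => simpa [shiftProd]
  | cons a l ih =>
    simp only [shiftProd_cons, Module.End.mul_apply, LinearMap.add_apply,
      Module.algebraMap_end_apply]
    exact V.add_mem (h _ ih) (V.smul_mem a ih)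

lemma Wo_eq (k : ℕ) (u : Fin k → K) (f : R) : Wo k u f = Plus Var.y
    (shiftProd (List.ofFn u) ((isLinearMap_Lam y_injective).mk' (Lam Var.y)) f) := by
  rw [Wo, prodLuY, foldr_comp_eq_shiftProd u (φ := LuY)]
  exact fun c f => rfl

lemma TZt_eq (k : ℕ) (u : Fin k → K) (f : R) : TZt k u f = ThZt (Ztplus
    (shiftProd (List.ofFn u) (isLinearMap_LamZt.mk' LamZt) (LamZt (X (Var.z 0) * f)))) := by
  rw [TZt, prodLuZt, foldr_comp_eq_shiftProd u (φ := LuZt)]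
  exact fun c f => rfl

lemma isLinearMap_Wo (k : ℕ) (u : Fin k → K) : IsLinearMap K (Wo k u) := by
  rw [show Wo k u = _ from funext (Wo_eq k u)]
  exact ((isLinearMap_Plus y_injective).mk' (Plus Var.y) ∘ₗ _).isLinear

lemma isLinearMap_TZt (k : ℕ) (u : Fin k → K) : IsLinearMap K (TZt k u) := by
  rw [show TZt k u = _ from funext (TZt_eq k u)]
  exact (isLinearMap_ThZt.mk' ThZt ∘ₗ isLinearMap_Ztplus.mk' Ztplus ∘ₗ
    shiftProd (List.ofFn u) (isLinearMap_LamZt.mk' LamZt) ∘ₗ isLinearMap_LamZt.mk' LamZt ∘ₗ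
    LinearMap.mulLeft K (X (Var.z 0))).isLinear

end products

section letterY
open Finsupp

/-- The part of the model lying over the polynomials linear in the `y`-variables. -/
def modelY : Submodule K (ℕ × ℕ →₀ A × A) :=
  Submodule.span K (Set.range fun x : ℕ × A => single (x.1, 0) (x.2, 0))

lemma single_mem_modelY (m : ℕ) (q : A) : single (m, 0) (q, 0) ∈ modelY :=
  Submodule.subset_span ⟨(m, q), rfl⟩

lemma map_mem_modelY {T : Module.End K (ℕ × ℕ →₀ A × A)}
    (h : ∀ m q, T (single (m, 0) (q, 0)) ∈ modelY) {v : ℕ × ℕ →₀ A × A} (hv : v ∈ modelY) :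
    T v ∈ modelY := by
  have : modelY ≤ modelY.comap T := Submodule.span_le.2 <| by
    rintro _ ⟨⟨m, q⟩, rfl⟩
    exact h m q
  exact this hv

lemma eq_on_modelY {M' : Type*} [AddCommGroup M'] [Module K M']
    {T U : (ℕ × ℕ →₀ A × A) →ₗ[K] M'}
    (h : ∀ m q, T (single (m, 0) (q, 0)) = U (single (m, 0) (q, 0))) {v : ℕ × ℕ →₀ A × A}
    (hv : v ∈ modelY) : T v = U v :=
  LinearMap.eqOn_span (f := T) (g := U) (by rintro _ ⟨⟨m, q⟩, rfl⟩; exact h m q) hv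

lemma modelL_mem_modelY {v : ℕ × ℕ →₀ A × A} (hv : v ∈ modelY) : modelL v ∈ modelY := by
  refine map_mem_modelY (fun m q => ?_) hv
  obtain ⟨N, hN⟩ := exists_bound q
  rw [modelL_single (N := N) fun i hi => by simp [hN i hi]]
  simp only [coeffD_apply, coeffP_apply, map_zero, mul_zero, Finset.range_zero, Finset.sum_empty,
    add_zero]
  refine add_mem (add_mem ?_ (sum_mem fun _ _ => single_mem_modelY _ _)) ?_
  · exact Submodule.smul_mem _ _ (sum_mem fun _ _ =>
      Submodule.smul_mem _ _ (single_mem_modelY _ _))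
  · exact Submodule.smul_mem _ _ (Submodule.smul_mem _ _ (single_mem_modelY _ _))

lemma sMul_mem_modelY {v : ℕ × ℕ →₀ A × A} (hv : v ∈ modelY) : sMul K (A × A) v ∈ modelY :=
  map_mem_modelY (fun m q => by rw [sMul_single]; exact single_mem_modelY _ _) hv

lemma emb_of_mem_modelY {v : ℕ × ℕ →₀ A × A} (hv : v ∈ modelY) :
    emb v = X (Var.z 0) * thetaEmb v :=
  eq_on_modelY (T := emb) (U := LinearMap.mulLeft K (X (Var.z 0)) ∘ₗ thetaEmb)
    (fun m q => by simp [thetaEmb_single, evalZ, mul_left_comm]) hv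

lemma thetaEmb_exchange {v : ℕ × ℕ →₀ A × A} (hv : v ∈ modelY) :
    thetaEmb (conjST (sMul K (A × A)) (coeffMap coeffH (swapST K (A × A) v)))
      = alpha • thetaEmb (sMul K (A × A) v) := by
  have := eq_on_modelY
    (T := thetaEmb ∘ₗ conjST (sMul K (A × A)) ∘ₗ coeffMap coeffH ∘ₗ swapST K (A × A))
    (U := alpha • (thetaEmb ∘ₗ sMul K (A × A))) (fun m q => ?_) hv
  · simpa only [LinearMap.comp_apply, LinearMap.smul_apply] using this
  · simp only [LinearMap.comp_apply, LinearMap.smul_apply, swapST_single, coeffMap_single,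
      coeffH_apply, conjST_single, sMul_single, thetaEmb_single]
    simp [evalZ]

lemma Wo_thetaEmb (k : ℕ) (u : Fin k → K) (v : ℕ × ℕ →₀ A × A) : Wo k u (thetaEmb v)
    = thetaEmb (sMul K (A × A) (shiftProd (List.ofFn u) modelL v)) := by
  rw [Wo_eq, shiftProd_intertwine Lam_thetaEmb, Plus_thetaEmb]

lemma TZt_thetaEmb (k : ℕ) (u : Fin k → K) {v : ℕ × ℕ →₀ A × A} (hv : v ∈ modelY) :
    TZt k u (thetaEmb v) = thetaEmb (conjST (sMul K (A × A))
      (shiftProd (List.ofFn u) (conjST modelL) (conjST modelL v))) := by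
  rw [TZt_eq, ← emb_of_mem_modelY hv, LamZt_emb, shiftProd_intertwine LamZt_emb, Ztplus_emb]
  rfl

lemma commutator_thetaEmb (k : ℕ) (u : Fin k → K) {v : ℕ × ℕ →₀ A × A} (hv : v ∈ modelY) :
    TZt k u (Wo k u (thetaEmb v)) - Wo k u (TZt k u (thetaEmb v))
      = alpha • Wo k u (Wo k u (thetaEmb v)) := by
  have hP := shiftProd_mem (fun _ => modelL_mem_modelY) (List.ofFn u) hv
  have key := LinearMap.congr_fun (sOp_commutator exists_creation.choose_spec
    exists_annihilation.choose_spec coeffD_coeffP coeffD_commute coeffP_commute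
    coeffH_commute_coeffD coeffH_commute_coeffP coeffH_mul_self (List.ofFn u)
    (L₁ := modelL) rfl rfl rfl rfl) v
  simp only [LinearMap.sub_apply, Module.End.mul_apply] at key
  rw [TZt_thetaEmb k u hv, Wo_thetaEmb, Wo_thetaEmb, TZt_thetaEmb k u (sMul_mem_modelY hP),
    ← map_sub, key, ← Wo_thetaEmb, thetaEmb_exchange hP, (isLinearMap_Wo k u).map_smul]

end letterY

section letterP

lemma Wo_inclP (k : ℕ) (u : Fin k → K) (q : A) : Wo k u (inclP q) = 0 := by
  rw [Wo_eq]
  refine Plus_eq_zero fun j => ?_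
  have h : shiftProd (List.ofFn u) ((isLinearMap_Lam y_injective).mk' (Lam Var.y)) (inclP q)
      ∈ LinearMap.range inclP.toLinearMap :=
    shiftProd_mem (by
      rintro _ ⟨q, rfl⟩
      rw [IsLinearMap.mk'_apply, AlgHom.toLinearMap_apply, Lam_eq_zero fun j => pderiv_y_inclP j q]
      exact zero_mem _) _ ⟨q, rfl⟩
  obtain ⟨r, hr⟩ := h
  rw [← hr]
  exact pderiv_y_inclP j r

/-- The polynomials that are linear in the `z`-variables with coefficients in `𝒫`. -/
def linearZ : Submodule K R :=
  Submodule.span K (Set.range fun x : ℕ × A => X (Var.z x.1) * inclP x.2)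

lemma z_mul_mem_linearZ (n : ℕ) (q : A) : X (Var.z n) * inclP q ∈ linearZ :=
  Submodule.subset_span ⟨(n, q), rfl⟩

lemma map_mem_of_linearZ {T : R → R} (hT : IsLinearMap K T) {V : Submodule K R}
    (h : ∀ n q, T (X (Var.z n) * inclP q) ∈ V) {f : R} (hf : f ∈ linearZ) : T f ∈ V := by
  have : linearZ ≤ V.comap (hT.mk' T) := Submodule.span_le.2 <| by
    rintro _ ⟨⟨n, q⟩, rfl⟩
    exact h n q
  exact this hf

lemma LamZt_mem_linearZ {f : R} (hf : f ∈ linearZ) : LamZt f ∈ linearZ := by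
  refine map_mem_of_linearZ isLinearMap_LamZt (fun n q => ?_) hf
  obtain ⟨N, hN⟩ := exists_bound q
  have e : MZ (X (Var.z n) * inclP q) = 0 := by
    have e₁ : ∀ i j, pderiv (Var.y i) (pderiv (Var.z j) (X (Var.z n) * inclP q)) = 0 := by
      intro i j
      rw [pderiv_letter z_injective (by simp)]
      split_ifs <;> simp
    have e₂ : ∀ j, pderiv (Var.z' j) (X (Var.z n) * inclP q) = 0 := by simp [pderiv_X]
    simp only [MZ, e₁, e₂, map_zero, mul_zero, finsum_zero, smul_zero, add_zero]
  rw [LamZt, e, Lam_eq_zero (a := Var.z') fun j => by simp [pderiv_X],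
    Lam_letter z_injective (by simp) n (N := N) fun i hi => by simp [hN i hi]]
  simp only [pderiv_p_inclP, ← inclP_X, ← map_mul, add_zero]
  refine add_mem (add_mem ?_ (sum_mem fun _ _ => z_mul_mem_linearZ _ _)) ?_
  · exact Submodule.smul_mem _ _ (sum_mem fun _ _ =>
      Submodule.smul_mem _ _ (z_mul_mem_linearZ _ _))
  · exact Submodule.smul_mem _ _ (Submodule.smul_mem _ _ (z_mul_mem_linearZ _ _))

lemma Ztplus_mem_linearZ {f : R} (hf : f ∈ linearZ) : Ztplus f ∈ linearZ := by
  refine map_mem_of_linearZ isLinearMap_Ztplus (fun n q => ?_) hf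
  rw [Ztplus, Plus_eq_zero (a := Var.z') fun j => by simp [pderiv_X],
    Plus_letter z_injective (by simp), add_zero]
  exact z_mul_mem_linearZ _ _

lemma exists_TZt_inclP_eq (k : ℕ) (u : Fin k → K) (q : A) : ∃ r, TZt k u (inclP q) = inclP r := by
  have h : TZt k u (inclP q) ∈ LinearMap.range inclP.toLinearMap := by
    rw [TZt_eq]
    refine map_mem_of_linearZ isLinearMap_ThZt (fun n q => ?_) (Ztplus_mem_linearZ
      (shiftProd_mem (fun _ => LamZt_mem_linearZ) _ (LamZt_mem_linearZ (z_mul_mem_linearZ 0 q))))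
    rw [ThZt_z n (by simp) (by simp), ← map_mul]
    exact ⟨_, rfl⟩
  obtain ⟨r, hr⟩ := h
  exact ⟨r, hr.symm⟩

lemma exists_inclP_eq {f : R} (hf : f ∈ (Psub : Set R)) : ∃ q, f = inclP q := by
  classical
  obtain ⟨g, rfl⟩ : f ∈ (rename ((↑) : Set.range Var.p → Var) :
      MvPolynomial (Set.range Var.p) K →ₐ[K] R).range := by
    rw [← supported_eq_range_rename]; exact hf
  refine ⟨rename (fun x => x.2.choose) g, ?_⟩
  rw [inclP, rename_rename]
  change rename _ g = _
  congr 2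
  funext x
  exact x.2.choose_spec.symm

end letterP

lemma alpha_ne_zero : alpha ≠ 0 := by
  have h : alpha = algebraMap (Polynomial ℚ) K (Polynomial.X + Polynomial.C 1) := by
    simp [alpha, bb, add_comm]
  rw [h]
  exact RatFunc.algebraMap_ne_zero (Polynomial.X_add_C_ne_zero 1)

/-- **Quadratic commutation relation** (first relation of Lemma 4.9 of Chapuy–Dołęga):
`[Ω_Z^{(k)} + □^{(k)}, Y_+∏_{i=1}^{k}(Λ_Y+u_i)] = (Y_+∏_{i=1}^{k}(Λ_Y+u_i))²`
as operators on `𝒫_Y`, where `Ω_Z^{(k)} + □^{(k)} = (1/(1+b))·T_Z̃`. -/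
theorem quadratic_commutation (k : ℕ) (hk : 1 ≤ k) (u : Fin k → K) :
    ∀ f ∈ PY,
      (1 + bb)⁻¹ • (TZt k u (Wo k u f) - Wo k u (TZt k u f)) = Wo k u (Wo k u f) := by
  intro f hf
  have key : TZt k u (Wo k u f) - Wo k u (TZt k u f) = alpha • Wo k u (Wo k u f) := by
    have hW := isLinearMap_Wo k u
    have hT := isLinearMap_TZt k u
    refine LinearMap.eqOn_span
      (f := hT.mk' (TZt k u) ∘ₗ hW.mk' (Wo k u) - hW.mk' (Wo k u) ∘ₗ hT.mk' (TZt k u))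
      (g := alpha • (hW.mk' (Wo k u) ∘ₗ hW.mk' (Wo k u))) ?_ hf
    rintro f (hf | ⟨i, f, hf, rfl⟩)
    · obtain ⟨q, rfl⟩ := exists_inclP_eq hf
      obtain ⟨r, hr⟩ := exists_TZt_inclP_eq k u q
      simp [hr, Wo_inclP, hT.map_zero, hW.map_zero]
    · obtain ⟨q, rfl⟩ := exists_inclP_eq hf
      have e : X (Var.y i) * inclP q = thetaEmb (Finsupp.single (i, 0) (q, 0)) := by
        simp [thetaEmb_single, evalZ]
      rw [e]
      exact commutator_thetaEmb k u (single_mem_modelY i q)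
  rw [key]
  exact inv_smul_smul₀ alpha_ne_zero _
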